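/- arXiv:1010.5552 — 12 statements merged into one kernel-verified Lean document; each statement's English description precedes it below -/
import Mathlib

section
/- Let D be a finite directed graph and let C be a directed cycle in D (a closed directed walk using each of its edges once). Let D' be the directed graph obtained from D by reversing the orientation of every edge of C and leaving all other edges unchanged. Then for all vertices u and v: u and v are mutually reachable in D if and only if u and v are mutually reachable in D'. In particular, D and D' have the same strongly connected components. -/
/-- Reachability in the finite directed graph with edge set `D`. -/
def DReach {V : Type} [Fintype V] [DecidableEq V] (D : Finset (V × V)) :
    V → V → Prop :=
  Relation.ReflTransGen fun a b => (a, b) ∈ D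

theorem cyc_back {V : Type} (c : List V) (R : V → V → Prop)
    (h : ∀ e ∈ c.zip (c.rotate 1), R e.1 e.2) (a b : V)
    (hab : (a, b) ∈ c.zip (c.rotate 1)) : Relation.ReflTransGen R b a := by
  obtain ⟨i, hi, hie⟩ := List.mem_iff_getElem.1 hab
  have hi' : i < c.length := by simpa using hi
  have hn : 0 < c.length := by omega
  have hm : ∀ k, k % c.length < c.length := fun k => Nat.mod_lt _ hn
  let f : ℕ → V := fun k => getElem c (k % c.length) (hm k)
  have hf : ∀ k, R (f k) (f (k + 1)) := by
    intro k
    have hk : k % c.length < (c.zip (c.rotate 1)).length := by simpa using hm k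
    have := h _ (List.getElem_mem hk)
    simpa [f, List.getElem_rotate] using this
  have hreach : ∀ i k, Relation.ReflTransGen R (f i) (f (i + k)) := by
    intro i k
    induction k with
    | zero => exact .refl
    | succ k ih => exact ih.tail (hf (i + k))
  have h1 : f (i + c.length) = a := by
    simp [List.getElem_rotate] at hie
    simp [f, Nat.mod_eq_of_lt hi', hie.1]
  have h2 : f (i + 1) = b := by
    simp [List.getElem_rotate] at hie
    simp [f, hie.2]
  have := hreach (i + 1) (c.length - 1)
  rwa [show i + 1 + (c.length - 1) = i + c.length by omega, h1, h2] at this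

/-- Let `D` be a finite directed graph and let `C` be a directed cycle in
`D` (a closed directed walk, given by the cyclically consecutive pairs of the vertex
list `c`, using each of its edges once).  If `D'` is obtained from `D` by reversing
every edge of `C` and leaving all other edges unchanged, then two vertices are mutually
reachable in `D` if and only if they are mutually reachable in `D'`; in particular `D`
and `D'` have the same strongly connected components. -/
theorem stmt0 {V : Type} [Fintype V] [DecidableEq V]
    (D : Finset (V × V)) (c : List V) (hc : c ≠ [])
    (hmem : ∀ e ∈ c.zip (c.rotate 1), e ∈ D)
    (hnodup : (c.zip (c.rotate 1)).Nodup)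
    (D' : Finset (V × V))
    (hD' : D' = (D \ (c.zip (c.rotate 1)).toFinset) ∪
      ((c.zip (c.rotate 1)).map Prod.swap).toFinset) :
    ∀ u v : V,
      (DReach D u v ∧ DReach D v u) ↔ (DReach D' u v ∧ DReach D' v u) := by
  have key : ∀ u v, DReach D u v ↔ DReach D' u v := by
    intro u v
    constructor
    · intro h
      refine Relation.reflTransGen_closed (r := fun a b => (a, b) ∈ _) ?_ u v h
      intro a b hab
      by_cases hz : (a, b) ∈ c.zip (c.rotate 1)
      · have := cyc_back c (fun x y => (y, x) ∈ D') (by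
          rintro ⟨x, y⟩ he
          rw [hD', Finset.mem_union]
          right
          rw [List.mem_toFinset, List.mem_map]
          exact ⟨(x, y), he, rfl⟩) a b hz
        exact Relation.reflTransGen_swap.1 this
      · refine .single ?_
        rw [hD', Finset.mem_union, Finset.mem_sdiff, List.mem_toFinset]
        exact Or.inl ⟨hab, hz⟩
    · intro h
      refine Relation.reflTransGen_closed (r := fun a b => (a, b) ∈ _) ?_ u v h
      intro a b hab
      rw [hD', Finset.mem_union, Finset.mem_sdiff, List.mem_toFinset, List.mem_toFinset,
        List.mem_map] at hab
      rcases hab with hab | ⟨⟨x, y⟩, he, hxy⟩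
      · exact .single hab.1
      · obtain ⟨rfl, rfl⟩ := Prod.mk.inj hxy
        exact cyc_back c (fun x y => (x, y) ∈ D) (fun e he => hmem e he) _ _ he
  intro u v
  rw [key u v, key v u]
end

section
/- Let G be a finite graph and let O1 and O2 be two equivalent orientations of G (every vertex has the same out-degree under both). Then for all vertices u and v: u and v are mutually reachable in the directed graph (G, O1) if and only if they are mutually reachable in (G, O2). Hence the strongly connected components of the two directed graphs are the same. -/
/-- An orientation of a finite graph with edge set `E`: each edge is assigned an initial
vertex (one of its endpoints). -/
structure EOrient {V : Type} [DecidableEq V] (E : Finset (Sym2 V)) where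
  init : {e // e ∈ E} → V
  init_mem : ∀ e, init e ∈ Subtype.val e

variable {V : Type} [Fintype V] [DecidableEq V]

/-- The terminal vertex of an edge under an orientation (the other endpoint). -/
noncomputable def EOrient.term {E : Finset (Sym2 V)} (O : EOrient E)
    (e : {e // e ∈ E}) : V :=
  Sym2.Mem.other' (O.init_mem e)

/-- The out-degree of a vertex under an orientation: the number of edges of which it is
the initial vertex. -/
def EOrient.outDeg {E : Finset (Sym2 V)} (O : EOrient E) (v : V) : ℕ :=
  (Finset.univ.filter fun e => O.init e = v).card

/-- A nonempty list of edges forms a directed cycle for the orientation `O`: cyclically,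
the terminal vertex of each edge is the initial vertex of the next one. -/
noncomputable def IsDirCycle {E : Finset (Sym2 V)} (O : EOrient E)
    (c : List {e // e ∈ E}) : Prop :=
  c ≠ [] ∧ ∀ pr ∈ c.zip (c.rotate 1), O.term pr.1 = O.init pr.2

/-- Reachability in the directed graph obtained from the orientation `O` of the edge
set `E`. -/
noncomputable def OReach {V : Type} [Fintype V] [DecidableEq V]
    {E : Finset (Sym2 V)} (O : EOrient E) : V → V → Prop :=
  Relation.ReflTransGen fun a b => ∃ e, O.init e = a ∧ O.term e = b

theorem EOrient.card_eq {V : Type} [Fintype V] [DecidableEq V] {E : Finset (Sym2 V)}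
    (O : EOrient E) (S : Finset V) :
    (Finset.univ.filter fun e => O.init e ∈ S).card = ∑ v ∈ S, O.outDeg v := by
  rw [Finset.card_eq_sum_card_fiberwise (f := O.init) (t := S)]
  · refine Finset.sum_congr rfl fun v hv => ?_
    unfold EOrient.outDeg
    congr 1
    ext e
    simp only [Finset.mem_filter, Finset.mem_univ, true_and]
    constructor
    · exact fun h => h.2
    · exact fun h => ⟨h ▸ hv, h⟩
  · intro e he
    simpa using he

theorem EOrient.mk_eq {V : Type} [Fintype V] [DecidableEq V] {E : Finset (Sym2 V)}
    (O : EOrient E) (e : {e // e ∈ E}) : s(O.init e, O.term e) = e.1 :=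
  Sym2.other_spec' (O.init_mem e)

theorem oreach_mono {V : Type} [Fintype V] [DecidableEq V] {E : Finset (Sym2 V)}
    (O1 O2 : EOrient E) (heq : ∀ v : V, O1.outDeg v = O2.outDeg v) (u v : V)
    (h : OReach O2 u v) : OReach O1 u v := by
  classical
  let S : Finset V := Finset.univ.filter fun x => OReach O1 u x
  have hS : ∀ x, x ∈ S ↔ OReach O1 u x := fun x => by simp [S]
  have hsub : (Finset.univ.filter fun e => O1.init e ∈ S) ⊆
      (Finset.univ.filter fun e => O2.init e ∈ S ∧ O2.term e ∈ S) := by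
    intro e he
    simp only [Finset.mem_filter, Finset.mem_univ, true_and] at he ⊢
    have ht : O1.term e ∈ S := (hS _).2 (((hS _).1 he).tail ⟨e, rfl, rfl⟩)
    have h12 := (O1.mk_eq e).trans (O2.mk_eq e).symm
    rcases Sym2.eq_iff.1 h12 with ⟨a, b⟩ | ⟨a, b⟩
    · exact ⟨a ▸ he, b ▸ ht⟩
    · exact ⟨b ▸ ht, a ▸ he⟩
  have hsub2 : (Finset.univ.filter fun e => O1.init e ∈ S) ⊆
      (Finset.univ.filter fun e => O2.init e ∈ S) := by
    intro e he
    have := hsub he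
    simp only [Finset.mem_filter, Finset.mem_univ, true_and] at this ⊢
    exact this.1
  have hE := Finset.eq_of_subset_of_card_le hsub2 (by
    rw [O1.card_eq, O2.card_eq]
    exact (Finset.sum_congr rfl fun v _ => heq v).ge)
  induction h with
  | refl => exact Relation.ReflTransGen.refl
  | tail _ hbc ih =>
    obtain ⟨e, rfl, rfl⟩ := hbc
    have he : e ∈ (Finset.univ.filter fun e => O2.init e ∈ S) := by
      simpa using (hS _).2 ih
    rw [← hE] at he
    have := hsub he
    simp only [Finset.mem_filter, Finset.mem_univ, true_and] at this
    exact (hS _).1 this.2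

/-- If two orientations `O1`, `O2` of a finite graph are equivalent (every
vertex has the same out-degree under both), then two vertices are mutually reachable in
the directed graph given by `O1` if and only if they are mutually reachable in the one
given by `O2`; hence the strongly connected components of the two directed graphs are
the same. -/
theorem stmt2 {V : Type} [Fintype V] [DecidableEq V] (E : Finset (Sym2 V))
    (hloop : ∀ e ∈ E, ¬ e.IsDiag)
    (O1 O2 : EOrient E) (heq : ∀ v : V, O1.outDeg v = O2.outDeg v) :
    ∀ u v : V,
      (OReach O1 u v ∧ OReach O1 v u) ↔ (OReach O2 u v ∧ OReach O2 v u) := by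
  intro u v
  have h1 := oreach_mono O1 O2 heq
  have h2 := oreach_mono O2 O1 fun v => (heq v).symm
  exact ⟨fun h => ⟨h2 _ _ h.1, h2 _ _ h.2⟩, fun h => ⟨h1 _ _ h.1, h1 _ _ h.2⟩⟩
end

section
/- Let d ≥ 1 and let G̃ = (I,P;E) be a pinned d-isostatic graph. Then G̃ admits a d-directed orientation, i.e., an orientation of its edges in which every inner vertex has out-degree exactly d and every pinned vertex has out-degree 0. -/
open Matrix

/-- A pinned graph: the vertex set `V` is partitioned into inner and pinned vertices,
and each edge is an unordered pair of distinct vertices with at least one inner endpoint. -/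
structure PinnedGraph (V : Type) [Fintype V] [DecidableEq V] where
  inner : Finset V
  pinned : Finset V
  disj : Disjoint inner pinned
  cover : inner ∪ pinned = Finset.univ
  edges : Finset (Sym2 V)
  loopless : ∀ e ∈ edges, ¬ e.IsDiag
  edge_inner : ∀ e ∈ edges, ∃ v, v ∈ e ∧ v ∈ inner

variable {V : Type} [Fintype V] [DecidableEq V]

/-- The pinned rigidity matrix in dimension `d`, with rows indexed by the edge set `E'`
and a block of `d` columns for each vertex of the inner-vertex set `I'`:  in the row of
edge `{u,v}` the block of an endpoint `u ∈ I'` is `p u - p v`, and all other blocks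
are zero. -/
noncomputable def rMatrix (d : ℕ) (p : V → EuclideanSpace ℝ (Fin d))
    (I' : Finset V) (E' : Finset (Sym2 V)) :
    Matrix {e // e ∈ E'} ({i // i ∈ I'} × Fin d) ℝ :=
  Matrix.of fun e ik =>
    if h : (ik.1 : V) ∈ (e : Sym2 V) then (p ik.1 - p (Sym2.Mem.other' h)) ik.2
    else 0

/-- A matrix has trivial kernel; for a square matrix this is invertibility. -/
def KernelTrivial {m n : Type} [Fintype n] (M : Matrix m n ℝ) : Prop :=
  ∀ U : n → ℝ, M.mulVec U = 0 → U = 0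

/-- The pinned graph with inner vertices `I'` and edges `E'` is pinned `d`-isostatic at the
configuration `p` : the edge count is `d|I'|` and the pinned rigidity matrix is invertible. -/
def IsostaticAt (d : ℕ) (p : V → EuclideanSpace ℝ (Fin d))
    (I' : Finset V) (E' : Finset (Sym2 V)) : Prop :=
  E'.card = d * I'.card ∧ KernelTrivial (rMatrix d p I' E')

/-- `(I',P';E')` is a subgraph of the pinned graph `G`. -/
structure IsSubgraph (G : PinnedGraph V) (I' P' : Finset V) (E' : Finset (Sym2 V)) : Prop where
  inner_sub : I' ⊆ G.inner
  pinned_sub : P' ⊆ G.pinned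
  edges_sub : E' ⊆ G.edges
  endpoints : ∀ e ∈ E', ∀ v ∈ e, v ∈ I' ∪ P'
  edge_inner : ∀ e ∈ E', ∃ v, v ∈ e ∧ v ∈ I'

/-- A `d`-Assur graph: a pinned `d`-isostatic graph with no proper pinned `d`-isostatic
subgraph having a nonempty inner-vertex set. -/
def IsAssur (d : ℕ) (G : PinnedGraph V) : Prop :=
  (∃ p, IsostaticAt d p G.inner G.edges) ∧
  ∀ I' P' E', IsSubgraph G I' P' E' → I'.Nonempty → E' ≠ G.edges →
    ¬ ∃ p, IsostaticAt d p I' E'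

/-- An orientation of the edges of a pinned graph: each edge is assigned an initial vertex. -/
structure GOrient (G : PinnedGraph V) where
  init : {e // e ∈ G.edges} → V
  init_mem : ∀ e, init e ∈ Subtype.val e

/-- The terminal vertex of an edge under an orientation. -/
noncomputable def GOrient.term {G : PinnedGraph V} (O : GOrient G)
    (e : {e // e ∈ G.edges}) : V :=
  Sym2.Mem.other' (O.init_mem e)

/-- The out-degree of a vertex under an orientation. -/
def GOrient.outDeg {G : PinnedGraph V} (O : GOrient G) (v : V) : ℕ :=
  (Finset.univ.filter fun e => O.init e = v).card

/-- A `d`-directed orientation: every inner vertex has out-degree `d` and every pinned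
vertex has out-degree `0`. -/
def IsDDirected (d : ℕ) {G : PinnedGraph V} (O : GOrient G) : Prop :=
  (∀ v ∈ G.inner, O.outDeg v = d) ∧ ∀ v ∈ G.pinned, O.outDeg v = 0

/-- A strongly `d`-Assur graph: a `d`-Assur graph such that on a dense open set of
configurations, deleting the row of any edge from the pinned rigidity matrix leaves a
matrix with a kernel vector that is nonzero at every inner vertex. -/
def IsStronglyAssur (d : ℕ) (G : PinnedGraph V) : Prop :=
  IsAssur d G ∧
  ∃ S : Set (V → EuclideanSpace ℝ (Fin d)), IsOpen S ∧ Dense S ∧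
    ∀ p ∈ S, ∀ e ∈ G.edges,
      ∃ U : {i // i ∈ G.inner} → EuclideanSpace ℝ (Fin d),
        (∀ i, U i ≠ 0) ∧
        (rMatrix d p G.inner (G.edges.erase e)).mulVec (fun ik => U ik.1 ik.2) = 0

/-- Every pinned `d`-isostatic graph admits a `d`-directed orientation:
every inner vertex has out-degree exactly `d` and every pinned vertex has out-degree `0`. -/
theorem stmt4 {V : Type} [Fintype V] [DecidableEq V] (d : ℕ) (hd : 1 ≤ d)
    (G : PinnedGraph V) (hiso : ∃ p, IsostaticAt d p G.inner G.edges) :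
    ∃ O : GOrient G, IsDDirected d O := by
  classical
  obtain ⟨p, hcard, hker⟩ := hiso
  set M := rMatrix d p G.inner G.edges with hM
  have hc : Fintype.card {e // e ∈ G.edges} = Fintype.card ({i // i ∈ G.inner} × Fin d) := by
    simp [hcard, mul_comm]
  let f : ({i // i ∈ G.inner} × Fin d) ≃ {e // e ∈ G.edges} := (Fintype.equivOfCardEq hc).symm
  have hdet : (M.submatrix f id).det ≠ 0 := by
    intro h0
    obtain ⟨v, hv, hv0⟩ := Matrix.exists_mulVec_eq_zero_iff.mpr h0
    apply hv
    apply hker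
    funext e
    have := congrFun hv0 (f.symm e)
    simpa [Matrix.mulVec, dotProduct, Matrix.submatrix] using this
  have hσ : ∃ σ : Equiv.Perm ({i // i ∈ G.inner} × Fin d), ∀ x, M (f (σ x)) x ≠ 0 := by
    by_contra! hno
    apply hdet
    rw [Matrix.det_apply]
    refine Finset.sum_eq_zero fun σ _ => ?_
    obtain ⟨x, hx⟩ := hno σ
    rw [Finset.prod_eq_zero (Finset.mem_univ x) (by simpa using hx), smul_zero]
  obtain ⟨σ, hσ⟩ := hσ
  let g : ({i // i ∈ G.inner} × Fin d) ≃ {e // e ∈ G.edges} := σ.trans f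
  have hg : ∀ x, (x.1 : V) ∈ (g x : Sym2 V) := by
    intro x
    by_contra hx
    exact hσ x (dif_neg hx)
  refine ⟨⟨fun e => ((g.symm e).1 : V), fun e => ?_⟩, ?_, ?_⟩
  · simpa using hg (g.symm e)
  · intro v hv
    simp only [GOrient.outDeg]
    have : (Finset.univ.filter fun e => ((g.symm e).1 : V) = v)
        = Finset.univ.image (fun k : Fin d => g (⟨v, hv⟩, k)) := by
      ext e
      simp only [Finset.mem_filter, Finset.mem_univ, true_and, Finset.mem_image]
      constructor
      · intro h
        refine ⟨(g.symm e).2, ?_⟩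
        rw [← Equiv.eq_symm_apply]
        exact Prod.ext (Subtype.ext h.symm) rfl
      · rintro ⟨k, rfl⟩
        simp
    rw [this, Finset.card_image_of_injective]
    · simp
    · intro a b h
      simpa using h
  · intro v hv
    simp only [GOrient.outDeg, Finset.card_eq_zero]
    refine Finset.filter_eq_empty_iff.mpr fun e _ h => ?_
    exact Finset.disjoint_left.mp G.disj (h ▸ (g.symm e).1.2) hv
end

section
/- Let d ≥ 1 and let G̃ = (I,P;E) be a pinned graph equipped with a d-directed orientation. For an inner vertex i, let E_i be the set of d edges directed out of i, and for e ∈ E_i let t(e) denote its terminal vertex. Then the set of configurations p : I ∪ P → ℝ^d such that, for every inner vertex i, the d × d matrix whose rows are the vectors p(i) − p(t(e)) for e ∈ E_i is invertible, is open and dense in (ℝ^d)^{I ∪ P}. (Consequently every d-directed orientation gives rise to a generically nonzero term in the block Laplace expansion of the determinant of the pinned rigidity matrix.) -/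
open Matrix

variable {V : Type} [Fintype V] [DecidableEq V]

theorem aux_term_ne {V : Type} [Fintype V] [DecidableEq V] {G : PinnedGraph V} (O : GOrient G)
    (e : {e // e ∈ G.edges}) : O.term e ≠ O.init e := by
  intro h
  have h1 := Sym2.other_spec' (O.init_mem e)
  apply G.loopless e.1 e.2
  rw [← h1]
  exact h.symm

theorem aux_term_inj {V : Type} [Fintype V] [DecidableEq V] {G : PinnedGraph V} (O : GOrient G)
    (e f : {e // e ∈ G.edges}) (hi : O.init e = O.init f) (ht : O.term e = O.term f) :
    e = f := by
  have h1 := Sym2.other_spec' (O.init_mem e)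
  have h2 := Sym2.other_spec' (O.init_mem f)
  apply Subtype.ext
  rw [← h1, ← h2]
  change s(O.init e, O.term e) = s(O.init f, O.term f)
  rw [hi, ht]

theorem aux_kernel {m : Type} {d : ℕ} (σ : Fin d ≃ m) (M : Matrix m (Fin d) ℝ) :
    KernelTrivial M ↔ (M.submatrix σ id).det ≠ 0 := by
  have key : ∀ U : Fin d → ℝ, M.mulVec U = 0 ↔ (M.submatrix σ id).mulVec U = 0 := by
    intro U
    constructor
    · intro h
      funext i
      exact congrFun h (σ i)
    · intro h
      funext i
      have := congrFun h (σ.symm i)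
      simpa [Matrix.mulVec, dotProduct] using this
  constructor
  · intro h hdet
    obtain ⟨v, hv, h0⟩ := Matrix.exists_mulVec_eq_zero_iff.mpr hdet
    exact hv (h v ((key v).mpr h0))
  · intro h U hU
    by_contra hne
    exact h (Matrix.exists_mulVec_eq_zero_iff.mp ⟨U, hne, (key U).mp hU⟩)

theorem aux_poly {d : ℕ} (A B : Matrix (Fin d) (Fin d) ℝ) (hB : B.det ≠ 0) :
    {t : ℝ | (t • B + A).det = 0}.Finite := by
  classical
  set P : Polynomial ℝ :=
    ((Polynomial.X : Polynomial ℝ) • B.map Polynomial.C + A.map Polynomial.C).det with hP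
  have hP0 : P ≠ 0 := by
    intro h
    apply hB
    rw [← Polynomial.coeff_det_X_add_C_card B A, ← hP, h]
    simp
  refine (P.roots.toFinset.finite_toSet).subset ?_
  intro t ht
  have : P.eval t = (t • B + A).det := by
    rw [hP, ← Polynomial.coe_evalRingHom, RingHom.map_det]
    congr 1
    ext i j
    simp
    exact mul_comm _ _
  simp only [Finset.mem_coe, Multiset.mem_toFinset]
  rw [Polynomial.mem_roots hP0, Polynomial.IsRoot, this]
  exact ht

theorem aux_dense {V : Type} [Fintype V] {d : ℕ} (v : V) (τ : Fin d → V)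
    (hτ : Function.Injective τ) (hv : ∀ k, τ k ≠ v) :
    Dense {p : V → EuclideanSpace ℝ (Fin d) |
      (Matrix.of fun (i k : Fin d) => (p v - p (τ i)) k).det ≠ 0} := by
  classical
  intro p
  let q : V → EuclideanSpace ℝ (Fin d) := fun w =>
    WithLp.toLp 2 (fun k => if τ k = w then (-1 : ℝ) else 0)
  let A : Matrix (Fin d) (Fin d) ℝ := Matrix.of fun (i k : Fin d) => (p v - p (τ i)) k
  have hfin := aux_poly A 1 (by simp)
  have hmem : ∀ t : ℝ, (t • (1 : Matrix (Fin d) (Fin d) ℝ) + A).det ≠ 0 →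
      p + t • q ∈ {p : V → EuclideanSpace ℝ (Fin d) |
      (Matrix.of fun (i k : Fin d) => (p v - p (τ i)) k).det ≠ 0} := by
    intro t ht
    simp only [Set.mem_setOf_eq]
    convert ht using 2
    ext i k
    simp only [Matrix.of_apply, Matrix.add_apply, Matrix.smul_apply, Matrix.one_apply, A, q,
      Pi.add_apply, Pi.smul_apply, PiLp.sub_apply, PiLp.add_apply, PiLp.smul_apply, hv,
      hτ.eq_iff, smul_eq_mul]
    by_cases h : i = k
    · subst h; simp; ring
    · have h' : ¬ k = i := fun e => h e.symm
      simp [h, h']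
  have hd : Dense {t : ℝ | (t • (1 : Matrix (Fin d) (Fin d) ℝ) + A).det = 0}ᶜ :=
    Set.Countable.dense_compl ℝ (Set.Finite.countable hfin)
  have hc : Continuous fun t : ℝ => p + t • q := by fun_prop
  have h0 := hd 0
  have := image_closure_subset_closure_image hc (Set.mem_image_of_mem _ h0)
  simp only [zero_smul, add_zero] at this
  refine closure_mono ?_ this
  rintro _ ⟨t, ht, rfl⟩
  exact hmem t ht

/-- For a pinned graph with a `d`-directed orientation, the set of
configurations `p` such that, for every inner vertex `i`, the `d × d` matrix whose rows
are the vectors `p i - p (t e)` over the `d` edges directed out of `i` is invertible,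
is open and dense in the configuration space. -/
theorem stmt5 {V : Type} [Fintype V] [DecidableEq V] (d : ℕ) (hd : 1 ≤ d)
    (G : PinnedGraph V) (O : GOrient G) (hO : IsDDirected d O) :
    IsOpen {p : V → EuclideanSpace ℝ (Fin d) | ∀ v ∈ G.inner,
        KernelTrivial (Matrix.of fun (e : {e : {e // e ∈ G.edges} // O.init e = v})
          (k : Fin d) => (p v - p (O.term e.1)) k)} ∧
    Dense {p : V → EuclideanSpace ℝ (Fin d) | ∀ v ∈ G.inner,
        KernelTrivial (Matrix.of fun (e : {e : {e // e ∈ G.edges} // O.init e = v})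
          (k : Fin d) => (p v - p (O.term e.1)) k)} := by
  have hσ : ∀ v ∈ G.inner,
      Nonempty (Fin d ≃ {e : {e // e ∈ G.edges} // O.init e = v}) := by
    intro v hv
    have h := hO.1 v hv
    unfold GOrient.outDeg at h
    rw [← Fintype.card_subtype] at h
    exact ⟨(Fintype.equivFinOfCardEq h).symm⟩
  have hopen : ∀ v ∈ G.inner, IsOpen {p : V → EuclideanSpace ℝ (Fin d) |
        KernelTrivial (Matrix.of fun (e : {e : {e // e ∈ G.edges} // O.init e = v})
          (k : Fin d) => (p v - p (O.term e.1)) k)} := by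
    intro v hv
    obtain ⟨σ⟩ := hσ v hv
    simp only [aux_kernel σ]
    refine isOpen_ne_fun ?_ continuous_const
    apply Continuous.matrix_det
    refine continuous_matrix fun i j => ?_
    simp only [Matrix.submatrix_apply, Matrix.of_apply]
    fun_prop
  have hdense : ∀ v ∈ G.inner, Dense {p : V → EuclideanSpace ℝ (Fin d) |
        KernelTrivial (Matrix.of fun (e : {e : {e // e ∈ G.edges} // O.init e = v})
          (k : Fin d) => (p v - p (O.term e.1)) k)} := by
    intro v hv
    obtain ⟨σ⟩ := hσ v hv
    simp only [aux_kernel σ]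
    refine aux_dense v (fun k => O.term (σ k).1) ?_ ?_
    · intro a b hab
      apply σ.injective
      apply Subtype.ext
      exact aux_term_inj O _ _ ((σ a).2.trans (σ b).2.symm) hab
    · intro k h
      exact aux_term_ne O (σ k).1 (h.trans (σ k).2.symm)
  have hset : {p : V → EuclideanSpace ℝ (Fin d) | ∀ v ∈ G.inner,
        KernelTrivial (Matrix.of fun (e : {e : {e // e ∈ G.edges} // O.init e = v})
          (k : Fin d) => (p v - p (O.term e.1)) k)} =
      ⋂ v ∈ (G.inner : Set V), {p : V → EuclideanSpace ℝ (Fin d) |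
        KernelTrivial (Matrix.of fun (e : {e : {e // e ∈ G.edges} // O.init e = v})
          (k : Fin d) => (p v - p (O.term e.1)) k)} := by
    ext p
    simp
  rw [hset]
  exact ⟨G.inner.finite_toSet.isOpen_biInter hopen,
    dense_biInter_of_isOpen hopen G.inner.finite_toSet.countable hdense⟩
end

section
/- Let d ≥ 1, let G̃ = (I,P;E) be a pinned graph and p a configuration with (G̃,p) pinned d-isostatic, and let O be a d-directed orientation of G̃. Let D ⊆ I be a nonempty set of inner vertices such that every edge whose initial vertex (under O) lies in D has its terminal vertex in D ∪ P, and let E_D be the set of edges whose initial vertex lies in D. Then |E_D| = d|D|, the triple (D, P; E_D) is a subgraph of G̃, and ((D,P;E_D), p) is pinned d-isostatic; i.e., the submatrix of R(G̃,p) with rows indexed by E_D and columns indexed by the column blocks of the vertices of D is invertible. -/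
open Matrix

variable {V : Type} [Fintype V] [DecidableEq V]

theorem aux_bij {m n : Type} [Fintype m] [Fintype n] (M : Matrix m n ℝ)
    (h : Fintype.card m = Fintype.card n) :
    Function.Injective M.mulVecLin ↔ Function.Surjective M.mulVecLin :=
  LinearMap.injective_iff_surjective_of_finrank_eq_finrank (by simp [h])

theorem aux_ker {m n : Type} [Fintype n] (M : Matrix m n ℝ) :
    KernelTrivial M ↔ Function.Injective M.mulVecLin := by
  rw [injective_iff_map_eq_zero]
  rfl

/-- In a pinned `d`-isostatic framework with a `d`-directed orientation,
for any nonempty set `D` of inner vertices closed under taking terminal vertices of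
outgoing edges (into `D ∪ P`), the set `E_D` of edges directed out of `D` satisfies
`|E_D| = d|D|`, the triple `(D, P; E_D)` is a subgraph, and it is pinned `d`-isostatic
at the same configuration. -/
theorem stmt6 {V : Type} [Fintype V] [DecidableEq V] (d : ℕ) (hd : 1 ≤ d)
    (G : PinnedGraph V) (p : V → EuclideanSpace ℝ (Fin d))
    (hiso : IsostaticAt d p G.inner G.edges)
    (O : GOrient G) (hO : IsDDirected d O)
    (D : Finset V) (hDsub : D ⊆ G.inner) (hDne : D.Nonempty)
    (hclosed : ∀ e : {e // e ∈ G.edges}, O.init e ∈ D → O.term e ∈ D ∪ G.pinned)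
    (ED : Finset (Sym2 V))
    (hED : ∀ a : Sym2 V, a ∈ ED ↔ ∃ h : a ∈ G.edges, O.init ⟨a, h⟩ ∈ D) :
    ED.card = d * D.card ∧ IsSubgraph G D G.pinned ED ∧ IsostaticAt d p D ED := by
  have hcard : ED.card = d * D.card := by
    have h1 : ED = (Finset.univ.filter fun e : {e // e ∈ G.edges} => O.init e ∈ D).map
        (Function.Embedding.subtype _) := by
      ext a
      simp [hED]
    rw [h1, Finset.card_map]
    rw [Finset.card_eq_sum_card_fiberwise (f := O.init) (t := D)
      (fun e he => by simpa using he)]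
    rw [Finset.sum_congr rfl (g := fun _ => d), Finset.sum_const, smul_eq_mul, mul_comm]
    intro v hv
    rw [← hO.1 v (hDsub hv), GOrient.outDeg, Finset.filter_filter]
    congr 1
    ext e
    simp only [Finset.mem_filter, Finset.mem_univ, true_and, and_iff_right_iff_imp]
    rintro rfl
    exact hv
  have hend : ∀ e ∈ ED, ∀ v ∈ e, v ∈ D ∪ G.pinned := by
    intro e he v hv
    obtain ⟨h, hi⟩ := (hED e).1 he
    have h2 := Sym2.other_spec' (O.init_mem ⟨e, h⟩)
    simp only at h2
    rw [← h2, Sym2.mem_iff] at hv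
    rcases hv with rfl | rfl
    · exact Finset.mem_union_left _ hi
    · exact hclosed ⟨e, h⟩ hi
  refine ⟨hcard, ⟨hDsub, subset_rfl, fun e he => ((hED e).1 he).1, hend, ?_⟩, hcard, ?_⟩
  · intro e he
    obtain ⟨h, hi⟩ := (hED e).1 he
    exact ⟨_, O.init_mem ⟨e, h⟩, hi⟩
  · have hs := (aux_bij _ (by simp [hiso.1, mul_comm])).1 ((aux_ker _).1 hiso.2)
    rw [aux_ker, aux_bij _ (by simp [hcard, mul_comm])]
    intro b
    obtain ⟨X, hX⟩ := hs (fun e => if h : (e : Sym2 V) ∈ ED then b ⟨e, h⟩ else 0)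
    refine ⟨fun ik => X (⟨ik.1, hDsub ik.1.2⟩, ik.2), ?_⟩
    ext e
    have hX' := congrFun hX ⟨e.1, ((hED e).1 e.2).1⟩
    simp only [e.2, dite_true] at hX'
    rw [← hX']
    simp only [Matrix.mulVecLin_apply, Matrix.mulVec, dotProduct]
    refine Finset.sum_of_injOn (fun ik => (⟨ik.1, hDsub ik.1.2⟩, ik.2)) ?_ ?_ ?_ ?_
    · rintro ⟨⟨a, ha⟩, k⟩ _ ⟨⟨b, hb⟩, l⟩ _ h
      simpa using h
    · intro _ _
      simp
    · rintro ⟨⟨a, ha⟩, k⟩ _ h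
      have hn : a ∉ (e : Sym2 V) := by
        intro hm
        rcases Finset.mem_union.1 (hend e e.2 a hm) with h' | h'
        · exact h ⟨(⟨a, h'⟩, k), by simp, rfl⟩
        · exact Finset.disjoint_left.1 G.disj ha h'
      simp [rMatrix, hn]
    · intro ik _
      rfl
end

section
/- Let d ≥ 1, let G̃ = (I,P;E) be a pinned d-isostatic graph with I nonempty, and let O be any d-directed orientation of G̃. Then the following are equivalent: (1) G̃ has no proper subgraph (I',P';E') with I' nonempty that is pinned d-isostatic (i.e., G̃ is d-Assur); (2) the directed graph on vertex set I whose edges are the edges of G̃ with both endpoints in I, oriented according to O, is strongly connected. -/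
open Matrix

variable {V : Type} [Fintype V] [DecidableEq V]

/-- One step of the inner digraph: a directed edge between two inner vertices. -/
def innerStep {V : Type} [Fintype V] [DecidableEq V] (G : PinnedGraph V)
    (O : GOrient G) : V → V → Prop :=
  fun a b => a ∈ G.inner ∧ b ∈ G.inner ∧ ∃ e, O.init e = a ∧ O.term e = b

lemma stmt7_mem_iff {V : Type} [Fintype V] [DecidableEq V] {G : PinnedGraph V}
    (O : GOrient G) (e : {e // e ∈ G.edges}) (v : V) :
    v ∈ (e : Sym2 V) ↔ v = O.init e ∨ v = O.term e := by
  have h : s(O.init e, O.term e) = (e : Sym2 V) := Sym2.other_spec' (O.init_mem e)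
  rw [← h, Sym2.mem_iff]

lemma stmt7_init_inner {V : Type} [Fintype V] [DecidableEq V] {d : ℕ} {G : PinnedGraph V}
    (O : GOrient G) (hO : IsDDirected d O) (e : {e // e ∈ G.edges}) :
    O.init e ∉ G.pinned := by
  intro h
  have h0 := hO.2 _ h
  unfold GOrient.outDeg at h0
  rw [Finset.card_eq_zero] at h0
  have : e ∈ (Finset.univ.filter fun e' => O.init e' = O.init e) := by simp
  rw [h0] at this
  simp at this

/-- The edges with initial vertex in `I'`. -/
def stmt7Out {V : Type} [Fintype V] [DecidableEq V] {G : PinnedGraph V}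
    (O : GOrient G) (I' : Finset V) : Finset (Sym2 V) :=
  (Finset.univ.filter fun e => O.init e ∈ I').map (Function.Embedding.subtype _)

lemma stmt7_mem_out {V : Type} [Fintype V] [DecidableEq V] {G : PinnedGraph V}
    (O : GOrient G) (I' : Finset V) (e : Sym2 V) :
    e ∈ stmt7Out O I' ↔ ∃ h : e ∈ G.edges, O.init ⟨e, h⟩ ∈ I' := by
  simp [stmt7Out]

lemma stmt7_card_out {V : Type} [Fintype V] [DecidableEq V] {d : ℕ} {G : PinnedGraph V}
    (O : GOrient G) (hO : IsDDirected d O) (I' : Finset V) (hI : I' ⊆ G.inner) :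
    (stmt7Out O I').card = d * I'.card := by
  rw [stmt7Out, Finset.card_map,
    Finset.card_eq_sum_card_fiberwise (f := O.init) (t := I')
      (by intro e he; simpa using he)]
  rw [Finset.sum_congr rfl (g := fun _ => d), Finset.sum_const, smul_eq_mul, mul_comm]
  intro v hv
  rw [← hO.1 v (hI hv), GOrient.outDeg, Finset.filter_filter]
  congr 1
  ext e
  simp only [Finset.mem_filter, Finset.mem_univ, true_and]
  constructor
  · exact fun h => h.2
  · exact fun h => ⟨h ▸ hv, h⟩

lemma stmt7_kernel {V : Type} [Fintype V] [DecidableEq V] (d : ℕ)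
    (p : V → EuclideanSpace ℝ (Fin d)) (I I' : Finset V) (E E' : Finset (Sym2 V))
    (hI : I' ⊆ I) (hE : E' ⊆ E) (hiso : IsostaticAt d p I E)
    (hcard : E'.card = d * I'.card)
    (hclosed : ∀ e ∈ E', ∀ v ∈ e, v ∈ I → v ∈ I') :
    KernelTrivial (rMatrix d p I' E') := by
  have hsurj : Function.Surjective (rMatrix d p I E).mulVecLin := by
    rw [← LinearMap.injective_iff_surjective_of_finrank_eq_finrank]
    · rw [injective_iff_map_eq_zero]
      exact hiso.2
    · simp [hiso.1, mul_comm]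
  have hsurj' : Function.Surjective (rMatrix d p I' E').mulVecLin := by
    intro b
    obtain ⟨U, hU⟩ := hsurj (fun e => if h : (e : Sym2 V) ∈ E' then b ⟨e, h⟩ else 0)
    refine ⟨fun ik => U (⟨ik.1, hI ik.1.2⟩, ik.2), ?_⟩
    ext e
    have h1 := congrFun hU ⟨e, hE e.2⟩
    simp only [e.2, dif_pos] at h1
    rw [← h1]
    simp only [Matrix.mulVecLin_apply, Matrix.mulVec, dotProduct]
    refine Fintype.sum_of_injective
      (fun ik : {i // i ∈ I'} × Fin d => ((⟨ik.1, hI ik.1.2⟩, ik.2) : {i // i ∈ I} × Fin d))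
      ?_ _ _ ?_ ?_
    · rintro ⟨⟨a, ha⟩, k⟩ ⟨⟨b, hb⟩, l⟩ h
      simpa using h
    · rintro ⟨⟨a, ha⟩, k⟩ hn
      have : a ∉ (e : Sym2 V) := by
        intro hae
        exact hn ⟨(⟨a, hclosed e e.2 a hae ha⟩, k), rfl⟩
      simp [rMatrix, this]
    · rintro ⟨⟨a, ha⟩, k⟩
      rfl
  have hinj : Function.Injective (rMatrix d p I' E').mulVecLin := by
    rw [LinearMap.injective_iff_surjective_of_finrank_eq_finrank]
    · exact hsurj'
    · simp [hcard, mul_comm]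
  rw [injective_iff_map_eq_zero] at hinj
  exact hinj

/-- A pinned `d`-isostatic graph with nonempty inner-vertex set is `d`-Assur
(has no proper pinned `d`-isostatic subgraph with nonempty inner-vertex set) if and only
if, for any `d`-directed orientation, the directed graph on the inner vertices (with the
inner-inner edges so oriented) is strongly connected. -/
theorem stmt7 {V : Type} [Fintype V] [DecidableEq V] (d : ℕ) (hd : 1 ≤ d)
    (G : PinnedGraph V) (hiso : ∃ p, IsostaticAt d p G.inner G.edges)
    (hI : G.inner.Nonempty) (O : GOrient G) (hO : IsDDirected d O) :
    (∀ I' P' E', IsSubgraph G I' P' E' → I'.Nonempty → E' ≠ G.edges →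
        ¬ ∃ q, IsostaticAt d q I' E') ↔
      (∀ u ∈ G.inner, ∀ v ∈ G.inner,
        Relation.ReflTransGen (innerStep G O) u v) := by
  constructor
  · intro hA u hu v hv
    by_contra huv
    classical
    obtain ⟨p, hp⟩ := hiso
    let I' := G.inner.filter fun w => Relation.ReflTransGen (innerStep G O) u w
    have hI' : I' ⊆ G.inner := Finset.filter_subset _ _
    have hEs : stmt7Out O I' ⊆ G.edges := by
      intro e he
      rw [stmt7_mem_out] at he
      exact he.1
    have hcl : ∀ e ∈ stmt7Out O I', ∀ w ∈ e, w ∈ G.inner → w ∈ I' := by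
      intro e he w hw hwi
      rw [stmt7_mem_out] at he
      obtain ⟨h, hi⟩ := he
      rcases (stmt7_mem_iff O ⟨e, h⟩ w).1 hw with rfl | hw
      · exact hi
      · have hi' := Finset.mem_filter.1 hi
        exact Finset.mem_filter.2 ⟨hwi, hi'.2.tail ⟨hi'.1, hwi, ⟨e, h⟩, rfl, hw.symm⟩⟩
    have hc := stmt7_card_out O hO I' hI'
    refine hA I' G.pinned (stmt7Out O I') ⟨hI', subset_rfl, hEs, ?_, ?_⟩
      ⟨u, Finset.mem_filter.2 ⟨hu, .refl⟩⟩ ?_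
      ⟨p, hc, stmt7_kernel d p _ _ _ _ hI' hEs hp hc hcl⟩
    · intro e he w hw
      have : w ∈ G.inner ∪ G.pinned := by rw [G.cover]; simp
      rcases Finset.mem_union.1 this with h | h
      · exact Finset.mem_union_left _ (hcl e he w hw h)
      · exact Finset.mem_union_right _ h
    · intro e he
      rw [stmt7_mem_out] at he
      obtain ⟨h, hi⟩ := he
      exact ⟨_, O.init_mem ⟨e, h⟩, hi⟩
    · intro heq
      rw [heq, hp.1] at hc
      have hlt : I'.card < G.inner.card := by
        apply Finset.card_lt_card
        rw [Finset.ssubset_iff_of_subset hI']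
        exact ⟨v, hv, fun h => huv (Finset.mem_filter.1 h).2⟩
      exact absurd (Nat.eq_of_mul_eq_mul_left hd hc) hlt.ne'
  · rintro hS I' P' E' hsub ⟨u, hu⟩ hne ⟨q, hq⟩
    apply hne
    have hEE : E' ⊆ stmt7Out O I' := by
      intro e he
      rw [stmt7_mem_out]
      refine ⟨hsub.edges_sub he, ?_⟩
      rcases Finset.mem_union.1 (hsub.endpoints e he _ (O.init_mem ⟨e, hsub.edges_sub he⟩)) with h | h
      · exact h
      · exact absurd (hsub.pinned_sub h) (stmt7_init_inner O hO _)
    have hEq : E' = stmt7Out O I' :=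
      Finset.eq_of_subset_of_card_le hEE
        (by rw [stmt7_card_out O hO I' hsub.inner_sub, hq.1])
    have hreach : ∀ w, Relation.ReflTransGen (innerStep G O) u w → w ∈ I' := by
      intro w hw
      induction hw with
      | refl => exact hu
      | tail _ hs ih =>
        obtain ⟨ha, hb, e, rfl, rfl⟩ := hs
        have he : (e : Sym2 V) ∈ E' := by
          rw [hEq, stmt7_mem_out]
          exact ⟨e.2, ih⟩
        rcases Finset.mem_union.1 (hsub.endpoints e he _
          ((stmt7_mem_iff O e _).2 (Or.inr rfl))) with h | h
        · exact h
        · exact absurd (hsub.pinned_sub h) (Finset.disjoint_left.1 G.disj hb)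
    apply Finset.Subset.antisymm hsub.edges_sub
    intro e he
    rw [hEq, stmt7_mem_out]
    refine ⟨he, hreach _ (hS u (hsub.inner_sub hu) _ ?_)⟩
    have : O.init ⟨e, he⟩ ∈ G.inner ∪ G.pinned := by rw [G.cover]; simp
    rcases Finset.mem_union.1 this with h | h
    · exact h
    · exact absurd h (stmt7_init_inner O hO _)
end

section
/- Let d ≥ 1, let G̃ = (I,P;E) be a pinned graph and p a configuration with (G̃,p) pinned d-isostatic. Let (I',P';E') be a subgraph of G̃ with k = |P'| ≤ d, and suppose that the points p(w), w ∈ P', are affinely independent and that the points p(v), v ∈ I' ∪ P', affinely span ℝ^d. Then |E'| ≤ d|I'| − C(d+1−k, 2), where C(m,2) = m(m−1)/2. (More generally, without the affine position hypotheses, |E'| ≤ d|I'| − dim T, where T is the space of vectors U ∈ (ℝ^d)^{I'} of the form U(i) = S·p(i) + t for a skew-symmetric d×d matrix S and t ∈ ℝ^d satisfying S·p(w) + t = 0 for all w ∈ P'.) -/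
open Matrix

variable {V : Type} [Fintype V] [DecidableEq V]

section Helpers

lemma s9_lin {d : ℕ} (l : EuclideanSpace ℝ (Fin d) →ₗ[ℝ] ℝ) (x : EuclideanSpace ℝ (Fin d)) :
    ∑ j, x j * l (EuclideanSpace.single j 1) = l x := by
  conv_rhs => rw [← (EuclideanSpace.basisFun (Fin d) ℝ).sum_repr x]
  simp [map_sum]

/-- Surjectivity of the rigidity map of the subgraph. -/
lemma s9_surj {V : Type} [Fintype V] [DecidableEq V] (d : ℕ)
    (G : PinnedGraph V) (p : V → EuclideanSpace ℝ (Fin d))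
    (hiso : IsostaticAt d p G.inner G.edges)
    (I' P' : Finset V) (E' : Finset (Sym2 V)) (hsub : IsSubgraph G I' P' E') :
    Function.Surjective (rMatrix d p I' E').mulVecLin := by
  classical
  obtain ⟨hc, hker⟩ := hiso
  have hinj : Function.Injective (rMatrix d p G.inner G.edges).mulVecLin := by
    rw [injective_iff_map_eq_zero]
    intro U hU
    exact hker U hU
  have hs : Function.Surjective (rMatrix d p G.inner G.edges).mulVecLin := by
    refine (LinearMap.injective_iff_surjective_of_finrank_eq_finrank ?_).1 hinj
    simp [hc, mul_comm]
  intro y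
  obtain ⟨U, hU⟩ := hs (fun e => if h : (e : Sym2 V) ∈ E' then y ⟨e, h⟩ else 0)
  refine ⟨fun ik => U (⟨ik.1, hsub.inner_sub ik.1.2⟩, ik.2), ?_⟩
  funext e
  have h1 := congrFun hU ⟨e, hsub.edges_sub e.2⟩
  simp only [e.2, dif_pos] at h1
  rw [← show (fun e => y e) = y from rfl]
  simp only
  rw [← h1]
  simp only [Matrix.mulVecLin_apply, Matrix.mulVec, dotProduct, Fintype.sum_prod_type, rMatrix,
    Matrix.of_apply]
  let F : V → ℝ := fun i => if hi : i ∈ G.inner then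
    ∑ j, (if h : i ∈ (e : Sym2 V) then (p i - p (Sym2.Mem.other' h)) j else 0) * U (⟨i, hi⟩, j)
    else 0
  have e1 : ∑ i ∈ I', F i = ∑ i ∈ G.inner, F i := by
    refine Finset.sum_subset hsub.inner_sub ?_
    intro i hi hi'
    have : i ∉ (e : Sym2 V) := by
      intro hie
      rcases Finset.mem_union.1 (hsub.endpoints e e.2 i hie) with h | h
      · exact hi' h
      · exact Finset.disjoint_left.1 G.disj hi (hsub.pinned_sub h)
    simp [F, this]
  rw [← Finset.sum_coe_sort I', ← Finset.sum_coe_sort G.inner] at e1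
  convert e1 using 2
  · rename_i i _
    simp only [F, dif_pos (hsub.inner_sub i.2)]
  · rename_i i _
    simp only [F, dif_pos i.2]

lemma s9_edge {V : Type} [Fintype V] [DecidableEq V] (d : ℕ)
    (p : V → EuclideanSpace ℝ (Fin d))
    (I' P' : Finset V) (e : Sym2 V) (hnd : ¬ e.IsDiag)
    (hend : ∀ v ∈ e, v ∈ I' ∪ P')
    (l : V → EuclideanSpace ℝ (Fin d) →ₗ[ℝ] ℝ) (hP : ∀ v ∈ P', l v = 0)
    (hl : ∀ u v, l u (p u - p v) = l v (p u - p v)) :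
    ∑ i ∈ I', (if h : i ∈ e then l i (p i - p (Sym2.Mem.other' h)) else 0) = 0 := by
  classical
  rw [Finset.sum_subset (Finset.subset_univ I')]
  · induction e using Sym2.ind with
    | _ u v =>
      have huv : u ≠ v := by simpa using hnd
      rw [Fintype.sum_eq_add u v huv]
      · have hu : u ∈ s(u, v) := by simp
        have hv : v ∈ s(u, v) := by simp
        have h1 : Sym2.Mem.other' hu = v := by
          exact Sym2.congr_right.1 (Sym2.other_spec' hu)
        have h2 : Sym2.Mem.other' hv = u := by
          exact Sym2.congr_right.1 ((Sym2.other_spec' hv).trans Sym2.eq_swap)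
        rw [dif_pos hu, dif_pos hv, h1, h2, hl u v, ← map_add]
        simp
      · intro x hx
        rw [dif_neg]
        simp [hx.1, hx.2]
  · intro i _ hi
    split_ifs with h
    · rcases Finset.mem_union.1 (hend i h) with h' | h'
      · exact absurd h' hi
      · simp [hP i h']
    · rfl

lemma s9_card (m : ℕ) :
    Fintype.card {ab : Fin m × Fin m // ab.1 < ab.2} = m.choose 2 := by
  classical
  rw [Fintype.card_subtype]
  have h : ∀ m : ℕ, (Finset.univ.filter (fun ab : Fin m × Fin m => ab.1 < ab.2)).card
      = ∑ i ∈ Finset.range m, i := by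
    intro m
    rw [← Fin.sum_univ_eq_sum_range (fun i => i) m]
    rw [Finset.card_filter, ← Finset.univ_product_univ, Finset.sum_product_right]
    refine Finset.sum_congr rfl fun b _ => ?_
    rw [← Finset.card_filter]
    have : (Finset.univ.filter fun x : Fin m => x < b) = Finset.Iio b := by ext; simp
    simp [this]
  rw [h, Finset.sum_range_id, Nat.choose_two_right]

/-- The skew matrix with given entries above the diagonal. -/
def s9B (m : ℕ) : ({ab : Fin m × Fin m // ab.1 < ab.2} → ℝ) →ₗ[ℝ] Matrix (Fin m) (Fin m) ℝ where
  toFun c := Matrix.of fun a b => if h : a < b then c ⟨(a, b), h⟩ else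
    if h : b < a then - c ⟨(b, a), h⟩ else 0
  map_add' c c' := by
    ext a b
    simp only [Matrix.of_apply, Matrix.add_apply, Pi.add_apply]
    split_ifs <;> ring
  map_smul' r c := by
    ext a b
    simp only [Matrix.of_apply, Matrix.smul_apply, Pi.smul_apply, RingHom.id_apply, smul_eq_mul]
    split_ifs <;> ring

lemma s9B_inj (m : ℕ) : Function.Injective (s9B m) := by
  rw [injective_iff_map_eq_zero]
  intro c hc
  funext ⟨⟨a, b⟩, h⟩
  have := congrFun (congrFun hc a) b
  simpa [s9B, show a < b from h] using this

lemma s9B_skew (m : ℕ) (c) (a b : Fin m) : s9B m c a b = - s9B m c b a := by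
  simp only [s9B, LinearMap.coe_mk, AddHom.coe_mk, Matrix.of_apply]
  rcases lt_trichotomy a b with h | h | h
  · simp [h, h.not_gt]
  · simp [h]
  · simp [h, h.not_gt]

lemma s9_bilin {m : ℕ} {Q : Type*} [AddCommGroup Q] [Module ℝ Q] (b : Module.Basis (Fin m) ℝ Q)
    (c) (x : Q) : Matrix.toBilin b (s9B m c) x x = 0 := by
  have : Matrix.toBilin b (s9B m c) x x = - Matrix.toBilin b (s9B m c) x x := by
    rw [Matrix.toBilin_apply]
    conv_lhs => rw [Finset.sum_comm]
    rw [← Finset.sum_neg_distrib]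
    refine Finset.sum_congr rfl fun i _ => ?_
    rw [← Finset.sum_neg_distrib]
    refine Finset.sum_congr rfl fun j _ => ?_
    rw [s9B_skew]; ring
  linarith

lemma s9_ker {V : Type} [Fintype V] [DecidableEq V] (d : ℕ)
    (G : PinnedGraph V) (p : V → EuclideanSpace ℝ (Fin d))
    (I' P' : Finset V) (E' : Finset (Sym2 V)) (hsub : IsSubgraph G I' P' E')
    (hindep : AffineIndependent ℝ (fun w : {w // w ∈ P'} => p w))
    (hspan : affineSpan ℝ (p '' ((I' ∪ P' : Finset V) : Set V)) = ⊤) :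
    (d + 1 - P'.card).choose 2 ≤
      Module.finrank ℝ (LinearMap.ker (rMatrix d p I' E').mulVecLin) := by
  classical
  let hat : V → (EuclideanSpace ℝ (Fin d) × ℝ) := fun v => (p v, 1)
  let N : Submodule ℝ (EuclideanSpace ℝ (Fin d) × ℝ) := Submodule.span ℝ (Set.range fun w : {w // w ∈ P'} => hat w)
  have hli : LinearIndependent ℝ (fun w : {w // w ∈ P'} => hat w) := by
    rw [Fintype.linearIndependent_iff]
    intro g hg
    have h1 := congrArg Prod.fst hg
    have h2 := congrArg Prod.snd hg
    simp only [Prod.fst_sum, Prod.snd_sum, hat, Prod.smul_mk, Prod.fst_zero, Prod.snd_zero,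
      smul_eq_mul, mul_one] at h1 h2
    intro i
    exact (affineIndependent_iff.1 hindep) Finset.univ g h2 h1 i (Finset.mem_univ i)
  have hN : Module.finrank ℝ N = P'.card := by
    have := finrank_span_eq_card hli
    simpa using this
  have hQ : Module.finrank ℝ ((EuclideanSpace ℝ (Fin d) × ℝ) ⧸ N) = d + 1 - P'.card := by
    have h := Submodule.finrank_quotient_add_finrank N
    have h3 : Module.finrank ℝ (EuclideanSpace ℝ (Fin d) × ℝ) = d + 1 := by simp
    omega
  let m := d + 1 - P'.card
  let b : Module.Basis (Fin m) ℝ ((EuclideanSpace ℝ (Fin d) × ℝ) ⧸ N) := Module.finBasisOfFinrankEq ℝ _ hQ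
  let β : ({ab : Fin m × Fin m // ab.1 < ab.2} → ℝ) → (EuclideanSpace ℝ (Fin d) × ℝ) → (EuclideanSpace ℝ (Fin d) × ℝ) → ℝ := fun c x y =>
    Matrix.toBilin b (s9B m c) (N.mkQ x) (N.mkQ y)
  have βself : ∀ c x, β c x x = 0 := fun c x => s9_bilin b c _
  have βP : ∀ c, ∀ v ∈ P', ∀ y, β c (hat v) y = 0 := by
    intro c v hv y
    have : N.mkQ (hat v) = 0 := by
      rw [Submodule.mkQ_apply, Submodule.Quotient.mk_eq_zero]
      exact Submodule.subset_span ⟨⟨v, hv⟩, rfl⟩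
    simp only [β, this, map_zero, LinearMap.zero_apply]
  let l : ({ab : Fin m × Fin m // ab.1 < ab.2} → ℝ) → V → EuclideanSpace ℝ (Fin d) →ₗ[ℝ] ℝ :=
    fun c v => (Matrix.toBilin b (s9B m c) (N.mkQ (hat v))) ∘ₗ N.mkQ ∘ₗ LinearMap.inl ℝ _ _
  have hl : ∀ c v x, l c v x = β c (hat v) (x, 0) := fun c v x => rfl
  let L : ({ab : Fin m × Fin m // ab.1 < ab.2} → ℝ) →ₗ[ℝ] ({i // i ∈ I'} × Fin d → ℝ) :=
    { toFun := fun c ik => l c ik.1 (EuclideanSpace.single ik.2 1)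
      map_add' := by
        intro c c'
        funext ik
        simp only [hl, β, map_add, LinearMap.add_apply, Pi.add_apply]
      map_smul' := by
        intro r c
        funext ik
        simp only [hl, β, map_smul, LinearMap.smul_apply, Pi.smul_apply, RingHom.id_apply] }
  have hLl : ∀ c i j, L c (i, j) = l c i (EuclideanSpace.single j 1) := fun _ _ _ => rfl
  have hLker : ∀ c, L c ∈ LinearMap.ker (rMatrix d p I' E').mulVecLin := by
    intro c
    rw [LinearMap.mem_ker]
    funext e
    have key := s9_edge d p I' P' e (G.loopless e (hsub.edges_sub e.2)) (hsub.endpoints e e.2)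
      (l c) (by
        intro v hv
        ext x
        rw [hl, βP c v hv]; rfl) (by
        intro u v
        rw [hl, hl]
        have h1 := βself c (p u - p v, 0)
        have h2 : ((p u - p v, 0) : (EuclideanSpace ℝ (Fin d) × ℝ)) = hat u - hat v := by simp [hat]
        have h3 : β c (p u - p v, 0) (p u - p v, 0)
          = β c (hat u) (p u - p v, 0) - β c (hat v) (p u - p v, 0) := by
          conv_lhs => enter [2]; rw [h2]
          simp only [β, map_sub, LinearMap.sub_apply]
        linarith)
    rw [← Finset.sum_coe_sort I'] at key
    rw [Pi.zero_apply, ← key]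
    simp only [Matrix.mulVecLin_apply, Matrix.mulVec, dotProduct, Fintype.sum_prod_type, rMatrix,
      Matrix.of_apply, hLl]
    refine Finset.sum_congr rfl fun i _ => ?_
    by_cases h : (i : V) ∈ (e : Sym2 V)
    · simp only [h, dif_pos]
      exact s9_lin (l c i) (p i - p (Sym2.Mem.other' h))
    · simp [h]
  have hLinj : Function.Injective L := by
    rw [injective_iff_map_eq_zero]
    intro c hc
    apply s9B_inj m
    rw [map_zero]
    apply (Matrix.toBilin b).injective
    rw [map_zero]
    have hz : ∀ v ∈ I' ∪ P', ∀ x, l c v x = 0 := by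
      intro v hv x
      rcases Finset.mem_union.1 hv with h | h
      · rw [← s9_lin]
        refine Finset.sum_eq_zero fun j _ => ?_
        have := congrFun hc (⟨v, h⟩, j)
        rw [hLl] at this
        simp only at this
        rw [this]; simp
      · rw [hl, βP c v h]
    have hz2 : ∀ v ∈ I' ∪ P', ∀ y, β c (hat v) y = 0 := by
      rintro v hv ⟨x, t⟩
      have h1 : ((x, t) : (EuclideanSpace ℝ (Fin d) × ℝ)) = (x - t • p v, 0) + t • hat v := by simp [hat]
      have h2 : β c (hat v) (x, t) = β c (hat v) (x - t • p v, 0) + t * β c (hat v) (hat v) := by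
        rw [h1]; simp only [β, map_add, map_smul, smul_eq_mul]
      rw [h2, ← hl, hz v hv, βself]; simp
    have hz3 : ∀ (x : EuclideanSpace ℝ (Fin d)) y, β c (x, 1) y = 0 := by
      intro x y
      have hx : x ∈ affineSpan ℝ (p '' ((I' ∪ P' : Finset V) : Set V)) := by
        rw [hspan]; trivial
      refine affineSpan_induction (p := fun x => β c (x, 1) y = 0) hx ?_ ?_
      · rintro x ⟨v, hv, rfl⟩
        exact hz2 v hv y
      · intro r u v w hu hv hw
        have h1 : ((r • (u -ᵥ v) +ᵥ w, 1) : (EuclideanSpace ℝ (Fin d) × ℝ)) = r • ((u, 1) - (v, 1)) + (w, 1) := by simp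
        rw [h1]
        have : β c (r • ((u, 1) - (v, 1)) + (w, 1)) y
            = r * (β c (u, 1) y - β c (v, 1) y) + β c (w, 1) y := by
          simp only [β, map_add, map_smul, map_sub, LinearMap.add_apply, LinearMap.smul_apply,
            LinearMap.sub_apply, smul_eq_mul]
        rw [this, hu, hv, hw]; simp
    have hz4 : ∀ x y, β c x y = 0 := by
      rintro ⟨x, t⟩ y
      have h1 : ((x, t) : (EuclideanSpace ℝ (Fin d) × ℝ)) = ((x, 1) - (0, 1)) + t • (0, 1) := by simp
      have : β c (x, t) y = (β c (x, 1) y - β c (0, 1) y) + t * β c (0, 1) y := by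
        rw [h1]
        simp only [β, map_add, map_smul, map_sub, LinearMap.add_apply, LinearMap.smul_apply,
            LinearMap.sub_apply, smul_eq_mul]
      rw [this, hz3, hz3]; simp
    refine LinearMap.ext fun x => LinearMap.ext fun y => ?_
    obtain ⟨x, rfl⟩ := N.mkQ_surjective x
    obtain ⟨y, rfl⟩ := N.mkQ_surjective y
    exact hz4 x y
  let L' := L.codRestrict (LinearMap.ker (rMatrix d p I' E').mulVecLin) hLker
  have hL' : Function.Injective L' := by
    intro x y hxy
    exact hLinj (congrArg Subtype.val hxy)
  have := LinearMap.finrank_le_finrank_of_injective hL'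
  rwa [Module.finrank_fintype_fun_eq_card, s9_card] at this

end Helpers

/-- In a pinned `d`-isostatic framework `(G,p)`, a subgraph `(I',P';E')`
with `k = |P'| ≤ d` pins whose pinned points are affinely independent and whose points
affinely span `ℝ^d` satisfies `|E'| ≤ d|I'| - C(d+1-k, 2)`. -/
theorem stmt9 {V : Type} [Fintype V] [DecidableEq V] (d : ℕ) (hd : 1 ≤ d)
    (G : PinnedGraph V) (p : V → EuclideanSpace ℝ (Fin d))
    (hiso : IsostaticAt d p G.inner G.edges)
    (I' P' : Finset V) (E' : Finset (Sym2 V)) (hsub : IsSubgraph G I' P' E')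
    (hk : P'.card ≤ d)
    (hindep : AffineIndependent ℝ (fun w : {w // w ∈ P'} => p w))
    (hspan : affineSpan ℝ (p '' ((I' ∪ P' : Finset V) : Set V)) = ⊤) :
    E'.card + (d + 1 - P'.card).choose 2 ≤ d * I'.card := by
  have hs := s9_surj d G p hiso I' P' E' hsub
  have hk2 := s9_ker d G p I' P' E' hsub hindep hspan
  have h := LinearMap.finrank_range_add_finrank_ker (rMatrix d p I' E').mulVecLin
  rw [LinearMap.range_eq_top.2 hs, finrank_top] at h
  simp only [Module.finrank_fintype_fun_eq_card, Fintype.card_prod, Fintype.card_coe,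
    Fintype.card_fin] at h
  rw [mul_comm d]
  omega
end

section
/- Let d ≥ 1 and let G̃ = (I,P;E) be a pinned graph such that |E| = d|I| and every subgraph (I',P';E') of G̃ satisfies |E'| ≤ d|I'|. Then G̃ admits a d-directed orientation: an orientation of its edges in which every inner vertex has out-degree exactly d and every pinned vertex has out-degree 0. -/
open Matrix

variable {V : Type} [Fintype V] [DecidableEq V]

/-- A pinned graph with `|E| = d|I|` all of whose subgraphs satisfy
`|E'| ≤ d|I'|` admits a `d`-directed orientation. -/
theorem stmt10 {V : Type} [Fintype V] [DecidableEq V] (d : ℕ) (hd : 1 ≤ d)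
    (G : PinnedGraph V) (hcard : G.edges.card = d * G.inner.card)
    (hsub : ∀ I' P' E', IsSubgraph G I' P' E' → E'.card ≤ d * I'.card) :
    ∃ O : GOrient G, IsDDirected d O := by
  classical
  let t : {e // e ∈ G.edges} → Finset (V × Fin d) := fun e =>
    (G.inner.filter (fun v => v ∈ e.val)) ×ˢ (Finset.univ : Finset (Fin d))
  have hall : ∀ s : Finset {e // e ∈ G.edges}, s.card ≤ (s.biUnion t).card := by
    intro s
    have h := hsub (G.inner.filter (fun v => ∃ e ∈ s, v ∈ e.val)) G.pinned
      (s.map (Function.Embedding.subtype _)) ?_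
    · have hU : s.biUnion t =
          (G.inner.filter (fun v => ∃ e ∈ s, v ∈ e.val)) ×ˢ (Finset.univ : Finset (Fin d)) := by
        ext ⟨v, k⟩
        simp only [t, Finset.mem_biUnion, Finset.mem_product, Finset.mem_filter,
          Finset.mem_univ, and_true]
        constructor
        · rintro ⟨e, he, hv, hve⟩
          exact ⟨hv, e, he, hve⟩
        · rintro ⟨hv, e, he, hve⟩
          exact ⟨e, he, hv, hve⟩
      rw [hU, Finset.card_product, Finset.card_univ, Fintype.card_fin, mul_comm]
      rwa [Finset.card_map] at h
    · have key : ∀ e ∈ s.map (Function.Embedding.subtype (fun e => e ∈ G.edges)),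
          ∃ h : e ∈ G.edges, (⟨e, h⟩ : {e // e ∈ G.edges}) ∈ s := by
        intro e he
        obtain ⟨a, ha, rfl⟩ := Finset.mem_map.1 he
        exact ⟨a.2, ha⟩
      refine ⟨Finset.filter_subset _ _, subset_rfl, fun e he => (key e he).1, ?_, ?_⟩
      · intro e he v hv
        obtain ⟨h1, h2⟩ := key e he
        have hc : v ∈ G.inner ∪ G.pinned := by rw [G.cover]; exact Finset.mem_univ v
        rcases Finset.mem_union.1 hc with h | h
        · exact Finset.mem_union_left _ (Finset.mem_filter.2 ⟨h, _, h2, hv⟩)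
        · exact Finset.mem_union_right _ h
      · intro e he
        obtain ⟨h1, h2⟩ := key e he
        obtain ⟨v, hv, hi⟩ := G.edge_inner e h1
        exact ⟨v, hv, Finset.mem_filter.2 ⟨hi, _, h2, hv⟩⟩
  obtain ⟨f, hf, hft⟩ := (Finset.all_card_le_biUnion_card_iff_exists_injective t).1 hall
  have hmem : ∀ e, (f e).1 ∈ G.inner ∧ (f e).1 ∈ e.val := by
    intro e
    exact Finset.mem_filter.1 (Finset.mem_product.1 (hft e)).1
  let O : GOrient G := ⟨fun e => (f e).1, fun e => (hmem e).2⟩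
  have hle : ∀ v, O.outDeg v ≤ d := by
    intro v
    have h1 : (Finset.univ.filter fun e => O.init e = v).card
        ≤ (Finset.univ : Finset (Fin d)).card := by
      apply Finset.card_le_card_of_injOn (fun e => (f e).2)
      · intro e _
        exact Finset.mem_coe.2 (Finset.mem_univ _)
      · intro a ha b hb hab
        have ha' : (f a).1 = v := (Finset.mem_filter.1 (Finset.mem_coe.1 ha)).2
        have hb' : (f b).1 = v := (Finset.mem_filter.1 (Finset.mem_coe.1 hb)).2
        exact hf (Prod.ext (ha'.trans hb'.symm) hab)
    rw [Finset.card_univ, Fintype.card_fin] at h1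
    exact h1
  have hsum : ∑ v ∈ G.inner, O.outDeg v = ∑ v ∈ G.inner, d := by
    have h := Finset.card_eq_sum_card_fiberwise (f := O.init)
      (s := (Finset.univ : Finset {e // e ∈ G.edges})) (t := G.inner)
      (fun e _ => (hmem e).1)
    rw [Finset.card_univ, Fintype.card_coe, hcard] at h
    rw [Finset.sum_const, smul_eq_mul, mul_comm, h]
    rfl
  refine ⟨O, (Finset.sum_eq_sum_iff_of_le (fun v _ => hle v)).1 hsum, ?_⟩
  intro v hv
  apply Finset.card_eq_zero.2
  apply Finset.filter_eq_empty_iff.2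
  intro e _ he
  exact Finset.disjoint_left.1 G.disj (hmem e).1 ((show (f e).1 = v from he) ▸ hv)
end

section
/- There exists a pinned graph G̃ = (I,P;E) with the following properties: |E| = 3|I|; every subgraph (I',P';E') of G̃ satisfies |E'| ≤ 3|I'|; every subgraph (I',P';E') with P' = ∅ and |I'| ≥ 3 satisfies |E'| ≤ 3|I'| − 6; and yet for every configuration p : I ∪ P → ℝ³ the pinned rigidity matrix R(G̃,p) is singular, so G̃ is not pinned 3-isostatic. (Such an example is given by a pinned version of the 'double banana' graph; hence the counting conditions that characterize pinned isostatic graphs in the plane are not sufficient in dimension 3.) -/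
open Matrix

variable {V : Type} [Fintype V] [DecidableEq V]

/-- The pinned banana: `0,1` are the tips, `2,3,4` the triangle, `5,6,7` the pins. -/
def bananaGraph : PinnedGraph (Fin 8) where
  inner := {0, 1, 2, 3, 4}
  pinned := {5, 6, 7}
  disj := by decide
  cover := by decide
  edges := {s(0,5), s(0,6), s(0,7), s(1,5), s(1,6), s(1,7),
    s(0,2), s(0,3), s(0,4), s(1,2), s(1,3), s(1,4), s(2,3), s(2,4), s(3,4)}
  loopless := by decide
  edge_inner := by decide

lemma banana_count1 : ∀ I' ∈ bananaGraph.inner.powerset,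
    (bananaGraph.edges.filter fun e =>
      (∀ v, v ∈ e → v ∈ I' ∪ bananaGraph.pinned) ∧ ∃ v, v ∈ e ∧ v ∈ I').card
      ≤ 3 * I'.card := by
  decide +kernel

lemma banana_count2 : ∀ I' ∈ bananaGraph.inner.powerset, 3 ≤ I'.card →
    (bananaGraph.edges.filter fun e => ∀ v, v ∈ e → v ∈ I').card + 6 ≤ 3 * I'.card := by
  decide +kernel

lemma rMatrix_mulVec_edge {n : ℕ} (d : ℕ) (p : Fin n → EuclideanSpace ℝ (Fin d))
    (I' : Finset (Fin n)) (E' : Finset (Sym2 (Fin n))) (W : Fin n → Fin d → ℝ)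
    (hW : ∀ i, i ∉ I' → W i = 0) (u v : Fin n) (huv : u ≠ v) (h : s(u, v) ∈ E') :
    (rMatrix d p I' E').mulVec (fun ik => W ik.1 ik.2) ⟨s(u, v), h⟩
      = ∑ k, (p u k - p v k) * (W u k - W v k) := by
  have ho1 : ∀ h : u ∈ s(u, v), Sym2.Mem.other' h = v := fun h => by
    exact Sym2.congr_right.1 (Sym2.other_spec' h)
  have ho2 : ∀ h : v ∈ s(u, v), Sym2.Mem.other' h = u := fun h => by
    exact Sym2.congr_right.1 ((Sym2.other_spec' h).trans Sym2.eq_swap)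
  let F : Fin n → ℝ := fun i => ∑ k,
    (if h : i ∈ s(u, v) then (p i - p (Sym2.Mem.other' h)) k else 0) * W i k
  have h1 : (rMatrix d p I' E').mulVec (fun ik => W ik.1 ik.2) ⟨s(u, v), h⟩
      = ∑ i : {i // i ∈ I'}, F i := by
    simp only [Matrix.mulVec, dotProduct, rMatrix, Matrix.of_apply, Fintype.sum_prod_type, F]
  have h2 : ∑ i : {i // i ∈ I'}, F i = ∑ i, F i := by
    rw [Finset.sum_coe_sort I' F]
    apply Finset.sum_subset (Finset.subset_univ _)
    intro i _ hi
    simp [F, hW i hi]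
  have h3 : ∑ i, F i = F u + F v := by
    apply Fintype.sum_eq_add u v huv
    rintro i ⟨hu, hv⟩
    simp [F, hu, hv]
  have hu : u ∈ s(u, v) := by simp
  have hv : v ∈ s(u, v) := by simp
  rw [h1, h2, h3]
  simp only [F, dif_pos hu, dif_pos hv, ho1, ho2]
  rw [← Finset.sum_add_distrib]
  apply Finset.sum_congr rfl
  intro k _
  simp only [PiLp.sub_apply]
  ring

lemma banana_kernel (p : Fin 8 → EuclideanSpace ℝ (Fin 3)) (W : Fin 8 → Fin 3 → ℝ)
    (h0 : W 0 = 0) (h1 : W 1 = 0) (h5 : W 5 = 0) (h6 : W 6 = 0) (h7 : W 7 = 0)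
    (hne : ∃ i ∈ bananaGraph.inner, W i ≠ 0)
    (hE : ∀ u v : Fin 8, (u = 0 ∨ u = 1 ∨ u = 2 ∨ u = 3 ∨ u = 4) →
       (v = 2 ∨ v = 3 ∨ v = 4) → ∑ k, (p u k - p v k) * (W u k - W v k) = 0) :
    ¬ KernelTrivial (rMatrix 3 p bananaGraph.inner bananaGraph.edges) := by
  intro hK
  obtain ⟨i, hi, hWi⟩ := hne
  apply hWi
  have := hK (fun ik => W ik.1 ik.2) ?_
  · funext k
    exact congrFun this (⟨i, hi⟩, k)
  funext ⟨e, he⟩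
  have hW : ∀ i, i ∉ bananaGraph.inner → W i = 0 := by
    intro i hi
    fin_cases i <;> first | assumption | exact absurd (by decide) hi
  have he' := he
  simp only [bananaGraph, Finset.mem_insert, Finset.mem_singleton] at he'
  rcases he' with rfl | rfl | rfl | rfl | rfl | rfl | rfl | rfl | rfl | rfl | rfl | rfl | rfl | rfl | rfl <;>
  rw [rMatrix_mulVec_edge 3 p _ _ W hW _ _ (by decide)] <;>
  first
    | (simp [h0, h1, h5, h6, h7]; done)
    | (exact hE _ _ (by decide) (by decide))

lemma banana_axis (q : Fin 3 → ℝ) : ∃ (d : Fin 3 → ℝ) (t : ℝ), d ≠ 0 ∧ q = t • d := by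
  by_cases h : q = 0
  · exact ⟨fun _ => 1, 0, fun h => by simpa using congrFun h 0, by simp [h]⟩
  · exact ⟨q, 1, h, by simp⟩

lemma banana_perp (d : Fin 3 → ℝ) : ∃ w : Fin 3 → ℝ, w ≠ 0 ∧
    d 0 * w 0 + d 1 * w 1 + d 2 * w 2 = 0 := by
  by_cases h : d 0 = 0
  · exact ⟨![1, 0, 0], fun h => by simpa using congrFun h 0, by simp [h]⟩
  · refine ⟨![d 1, - d 0, 0], fun h' => h (by simpa using congrFun h' 1), ?_⟩
    simp
    ring

/-- Parallel to a nonzero vector. -/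
lemma banana_par (d q w : Fin 3 → ℝ) (hd : d ≠ 0) (hc : d ⨯₃ q = 0)
    (hw : d 0 * w 0 + d 1 * w 1 + d 2 * w 2 = 0) :
    q 0 * w 0 + q 1 * w 1 + q 2 * w 2 = 0 := by
  have e0 := congrFun hc 0
  have e1 := congrFun hc 1
  have e2 := congrFun hc 2
  simp [cross_apply] at e0 e1 e2
  have key : ∀ k, d k * (q 0 * w 0 + q 1 * w 1 + q 2 * w 2) = 0 := by
    intro k
    fin_cases k <;> simp only [Fin.zero_eta, Fin.mk_one, Fin.reduceFinMk]
    · linear_combination q 0 * hw + w 1 * e2 - w 2 * e1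
    · linear_combination q 1 * hw - w 0 * e2 + w 2 * e0
    · linear_combination q 2 * hw + w 0 * e1 - w 1 * e0
  by_contra hne
  apply hd
  funext k
  exact (mul_eq_zero.mp (key k)).resolve_right hne

lemma banana_singular (p : Fin 8 → EuclideanSpace ℝ (Fin 3)) :
    ¬ KernelTrivial (rMatrix 3 p bananaGraph.inner bananaGraph.edges) := by
  obtain ⟨d, t, hd, hq⟩ := banana_axis (fun k => p 1 k - p 0 k)
  have hq' : ∀ k, p 1 k - p 0 k = t * d k := fun k => congrFun hq k
  let r : Fin 8 → Fin 3 → ℝ := fun i k => p i k - p 0 k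
  by_cases hcol : d ⨯₃ r 2 = 0 ∧ d ⨯₃ r 3 = 0 ∧ d ⨯₃ r 4 = 0
  · obtain ⟨w, hw, hdw⟩ := banana_perp d
    have r0 : r 0 0 * w 0 + r 0 1 * w 1 + r 0 2 * w 2 = 0 := by simp [r]
    have r1 : r 1 0 * w 0 + r 1 1 * w 1 + r 1 2 * w 2 = 0 := by
      simp only [r, hq']
      linear_combination t * hdw
    have r2 := banana_par d (r 2) w hd hcol.1 hdw
    have r3 := banana_par d (r 3) w hd hcol.2.1 hdw
    have r4 := banana_par d (r 4) w hd hcol.2.2 hdw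
    simp only [r] at r0 r1 r2 r3 r4
    apply banana_kernel p (fun i => if i = 2 then w else 0) (by simp) (by simp) (by simp) (by simp)
      (by simp) ⟨2, by decide, by simpa using hw⟩
    intro u v hu hv
    rcases hu with rfl | rfl | rfl | rfl | rfl <;> rcases hv with rfl | rfl | rfl <;>
      simp [Fin.sum_univ_three] <;> linarith
  · let W : Fin 8 → Fin 3 → ℝ := fun i => if i = 2 ∨ i = 3 ∨ i = 4 then d ⨯₃ r i else 0
    have hW : ∀ u : Fin 8, (u = 0 ∨ u = 1 ∨ u = 2 ∨ u = 3 ∨ u = 4) → W u = d ⨯₃ r u := by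
      intro u hu
      rcases hu with rfl | rfl | h
      · have : r 0 = 0 := by funext k; simp [r]
        simp [W, this]
      · have : r 1 = t • d := hq
        simp [W, this]
      · simp only [W, if_pos h]
    apply banana_kernel p W (by simp [W]) (by simp [W]) (by simp [W]) (by simp [W]) (by simp [W])
    · by_contra! hcon
      apply hcol
      refine ⟨?_, ?_, ?_⟩
      · rw [← hW 2 (by decide)]; exact hcon 2 (by decide)
      · rw [← hW 3 (by decide)]; exact hcon 3 (by decide)
      · rw [← hW 4 (by decide)]; exact hcon 4 (by decide)
    · intro u v hu hv
      rw [hW u hu, hW v (by tauto)]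
      simp [Fin.sum_univ_three, cross_apply, r]
      ring

/-- There is a pinned graph (a pinned `double banana') satisfying
`|E| = 3|I|`, the subgraph counts `|E'| ≤ 3|I'|`, and `|E'| ≤ 3|I'| - 6` for unpinned
subgraphs on at least `3` vertices, whose pinned rigidity matrix is nevertheless
singular at every configuration in `ℝ³`; hence it is not pinned `3`-isostatic. -/
theorem stmt11 :
    ∃ (n : ℕ) (G : PinnedGraph (Fin n)),
      G.edges.card = 3 * G.inner.card ∧
      (∀ I' P' E', IsSubgraph G I' P' E' → E'.card ≤ 3 * I'.card) ∧
      (∀ I' P' E', IsSubgraph G I' P' E' → P' = ∅ → 3 ≤ I'.card →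
        E'.card + 6 ≤ 3 * I'.card) ∧
      ∀ p : Fin n → EuclideanSpace ℝ (Fin 3),
        ¬ KernelTrivial (rMatrix 3 p G.inner G.edges) := by
  refine ⟨8, bananaGraph, by decide, ?_, ?_, banana_singular⟩
  · intro I' P' E' h
    refine le_trans (Finset.card_le_card ?_) (banana_count1 I' (Finset.mem_powerset.2 h.inner_sub))
    intro e he
    refine Finset.mem_filter.2 ⟨h.edges_sub he, fun v hv => ?_, h.edge_inner e he⟩
    exact Finset.union_subset_union_right h.pinned_sub (h.endpoints e he v hv)
  · intro I' P' E' h hP hI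
    refine le_trans (Nat.add_le_add_right (Finset.card_le_card ?_) 6)
      (banana_count2 I' (Finset.mem_powerset.2 h.inner_sub) hI)
    intro e he
    refine Finset.mem_filter.2 ⟨h.edges_sub he, fun v hv => ?_⟩
    simpa [hP] using h.endpoints e he v hv
end

section
/- Let d ≥ 1 and let G̃ = (I,P;E) be a pinned graph with I nonempty and |E| = d|I|. Suppose there is a dense subset S of the configuration space (ℝ^d)^{I ∪ P} such that for every p ∈ S: the pinned rigidity matrix R(G̃,p) is invertible, and for every edge e ∈ E there exists a vector U ∈ (ℝ^d)^I with U(i) ≠ 0 for every inner vertex i ∈ I and M·U = 0, where M is the matrix obtained from R(G̃,p) by deleting the row of e. Then G̃ is a d-Assur graph, i.e., G̃ has no proper subgraph with nonempty inner vertex set that is pinned d-isostatic. -/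
open Matrix

variable {V : Type} [Fintype V] [DecidableEq V]

/-- Openness of the trivial-kernel condition. -/
theorem kernelTrivial_iff_det {m n : Type} [Fintype m] [Fintype n] [DecidableEq n]
    (M : Matrix m n ℝ) : KernelTrivial M ↔ (Mᵀ * M).det ≠ 0 := by
  have key : ∀ v : n → ℝ, (Mᵀ * M) *ᵥ v = 0 ↔ M *ᵥ v = 0 := fun v => by
    have := Matrix.conjTranspose_mul_self_mulVec_eq_zero M v
    rwa [Matrix.conjTranspose_eq_transpose_of_trivial] at this
  rw [Ne, ← Matrix.exists_mulVec_eq_zero_iff]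
  constructor
  · rintro h ⟨v, hv, h0⟩
    exact hv (h v ((key v).1 h0))
  · intro h U hU
    by_contra hne
    exact h ⟨U, hne, (key U).2 hU⟩

theorem isOpen_kernelTrivial {V : Type} [Fintype V] [DecidableEq V] (d : ℕ)
    (I' : Finset V) (E' : Finset (Sym2 V)) :
    IsOpen {p : V → EuclideanSpace ℝ (Fin d) | KernelTrivial (rMatrix d p I' E')} := by
  simp only [kernelTrivial_iff_det]
  have hc : Continuous fun p : V → EuclideanSpace ℝ (Fin d) => rMatrix d p I' E' := by
    refine continuous_matrix fun e ik => ?_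
    simp only [rMatrix, Matrix.of_apply]
    split_ifs <;> fun_prop
  exact isOpen_ne_fun ((hc.matrix_transpose.matrix_mul hc).matrix_det) continuous_const

/-- If on a dense set of configurations the pinned rigidity matrix of a
pinned graph with `|E| = d|I|` is invertible and, for each edge, deleting its row leaves
a kernel vector that is nonzero at every inner vertex, then the graph is `d`-Assur. -/
theorem stmt12 {V : Type} [Fintype V] [DecidableEq V] (d : ℕ) (hd : 1 ≤ d)
    (G : PinnedGraph V) (hI : G.inner.Nonempty)
    (hcard : G.edges.card = d * G.inner.card)
    (S : Set (V → EuclideanSpace ℝ (Fin d))) (hS : Dense S)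
    (h : ∀ p ∈ S, KernelTrivial (rMatrix d p G.inner G.edges) ∧
      ∀ e ∈ G.edges, ∃ U : {i // i ∈ G.inner} → EuclideanSpace ℝ (Fin d),
        (∀ i, U i ≠ 0) ∧
        (rMatrix d p G.inner (G.edges.erase e)).mulVec (fun ik => U ik.1 ik.2) = 0) :
    IsAssur d G := by
  refine ⟨?_, ?_⟩
  · obtain ⟨p, hp⟩ := hS.nonempty
    exact ⟨p, hcard, (h p hp).1⟩
  rintro I' P' E' hsub ⟨i, hi⟩ hne ⟨p0, -, hp0⟩
  obtain ⟨p, hp, hpS⟩ := hS.inter_open_nonempty _ (isOpen_kernelTrivial d I' E') ⟨p0, hp0⟩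
  have hp : KernelTrivial (rMatrix d p I' E') := hp
  obtain ⟨e, he, heE⟩ : ∃ e ∈ G.edges, e ∉ E' := by
    by_contra! hc
    exact hne (hsub.edges_sub.antisymm hc)
  obtain ⟨U, hU, hU0⟩ := (h p hpS).2 e he
  have h0 := hp (fun ik => U ⟨ik.1, hsub.inner_sub ik.1.2⟩ ik.2) ?_
  · apply hU ⟨i, hsub.inner_sub hi⟩
    ext k
    exact congrFun h0 (⟨i, hi⟩, k)
  · funext f
    have hf : (f : Sym2 V) ∈ G.edges.erase e :=
      Finset.mem_erase.2 ⟨fun hh => heE (hh ▸ f.2), hsub.edges_sub f.2⟩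
    have h1 := congrFun hU0 ⟨f, hf⟩
    rw [Pi.zero_apply] at h1 ⊢
    rw [← h1]
    simp only [Matrix.mulVec, dotProduct]
    refine Fintype.sum_of_injective
      (fun ik : {i // i ∈ I'} × Fin d =>
        ((⟨ik.1, hsub.inner_sub ik.1.2⟩, ik.2) : {i // i ∈ G.inner} × Fin d)) ?_ _ _ ?_ ?_
    · rintro ⟨⟨a, ha⟩, k⟩ ⟨⟨b, hb⟩, l⟩ hab
      simpa using hab
    · rintro ⟨⟨a, ha⟩, k⟩ hnot
      have haI : a ∉ I' := fun hh => hnot ⟨(⟨a, hh⟩, k), rfl⟩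
      have haf : a ∉ (f : Sym2 V) := by
        intro hh
        rcases Finset.mem_union.1 (hsub.endpoints f f.2 a hh) with h2 | h2
        · exact haI h2
        · exact Finset.disjoint_left.1 G.disj ha (hsub.pinned_sub h2)
      simp [rMatrix, haf]
    · rintro ⟨⟨a, ha⟩, k⟩
      simp [rMatrix]
end

section
/- Let G̃ = (I,P;E) be a 2-Assur graph. Then there is a dense open set of configurations p : I ∪ P → ℝ² such that R(G̃,p) is invertible and, for every edge e ∈ E, the kernel of the matrix obtained from R(G̃,p) by deleting the row of e is one-dimensional and every nonzero vector U in this kernel satisfies U(i) ≠ 0 for every inner vertex i ∈ I. In particular every 2-Assur graph is strongly 2-Assur: at a generic configuration, removal of any edge yields an infinitesimal motion that is nonzero at all inner vertices. -/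
open Matrix

variable {V : Type} [Fintype V] [DecidableEq V]

abbrev Cfg (V : Type) := V → EuclideanSpace ℝ (Fin 2)

def extz (I' : Finset V) (X : {i // i ∈ I'} × Fin 2 → ℝ) : V → Fin 2 → ℝ :=
  fun v k => if h : v ∈ I' then X (⟨v, h⟩, k) else 0

def Lf (p : Cfg V) (Y : V → Fin 2 → ℝ) (a b : V) : ℝ :=
  (p a 0 - p b 0) * (Y a 0 - Y b 0) + (p a 1 - p b 1) * (Y a 1 - Y b 1)

lemma other_left (a b : V) (h : a ∈ s(a,b)) : Sym2.Mem.other' h = b := by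
  have := Sym2.other_spec' h
  exact Sym2.congr_right.1 this

lemma other_right (a b : V) (h : b ∈ s(a,b)) : Sym2.Mem.other' h = a := by
  have := Sym2.other_spec' h
  exact Sym2.congr_right.1 (this.trans Sym2.eq_swap)

lemma mulVec_eq (p : Cfg V) (I' : Finset V) (E' : Finset (Sym2 V))
    (X : {i // i ∈ I'} × Fin 2 → ℝ) (a b : V) (h : s(a,b) ∈ E') (hab : a ≠ b) :
    (rMatrix 2 p I' E').mulVec X ⟨s(a,b), h⟩ = Lf p (extz I' X) a b := by
  have key : ∀ (i : {i // i ∈ I'}) (k : Fin 2),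
      rMatrix 2 p I' E' ⟨s(a,b), h⟩ (i,k) * X (i,k) =
      (fun v : V => (if v = a then (p a k - p b k) * extz I' X a k else 0) +
        (if v = b then (p b k - p a k) * extz I' X b k else 0)) i := by
    rintro ⟨i, hi⟩ k
    by_cases h1 : i = a
    · subst h1
      simp [rMatrix, extz, hi, hab, other_left]
    · by_cases h2 : i = b
      · subst h2
        simp [rMatrix, extz, hi, hab.symm, other_right]
      · simp [rMatrix, h1, h2]
  have e0 : ∀ v k, v ∉ I' → extz I' X v k = 0 := by
    intro v k hv; simp [extz, hv]
  simp only [mulVec, dotProduct, Fintype.sum_prod_type]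
  rw [Finset.sum_comm]
  simp only [key]
  have : ∀ k : Fin 2, (∑ i : {i // i ∈ I'}, (fun v : V => (if v = a then (p a k - p b k) * extz I' X a k else 0) +
        (if v = b then (p b k - p a k) * extz I' X b k else 0)) i) = (p a k - p b k) * (extz I' X a k - extz I' X b k) := by
    intro k
    rw [Finset.sum_coe_sort I' (fun v : V => (if v = a then (p a k - p b k) * extz I' X a k else 0) +
        (if v = b then (p b k - p a k) * extz I' X b k else 0)), Finset.sum_add_distrib,
        Finset.sum_ite_eq', Finset.sum_ite_eq']
    by_cases ha : a ∈ I' <;> by_cases hb : b ∈ I' <;> simp [ha, hb, e0] <;> ring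
  simp only [this, Fin.sum_univ_two, Lf]

lemma Lf_congr (p : Cfg V) (Y Y' : V → Fin 2 → ℝ) (a b : V) (ha : Y a = Y' a) (hb : Y b = Y' b) :
    Lf p Y a b = Lf p Y' a b := by simp [Lf, ha, hb]

/-- congruence for general edge -/
lemma mulVec_congr (p : Cfg V) (I₁ I₂ : Finset V) (E₁ E₂ : Finset (Sym2 V))
    (X₁ : {i // i ∈ I₁} × Fin 2 → ℝ) (X₂ : {i // i ∈ I₂} × Fin 2 → ℝ) (f : Sym2 V) (h₁ : f ∈ E₁)
    (h₂ : f ∈ E₂) (hf : ¬ f.IsDiag)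
    (hX : ∀ v ∈ f, extz I₁ X₁ v = extz I₂ X₂ v) :
    (rMatrix 2 p I₁ E₁).mulVec X₁ ⟨f, h₁⟩ = (rMatrix 2 p I₂ E₂).mulVec X₂ ⟨f, h₂⟩ := by
  induction f with | _ a b
  have hab : a ≠ b := by simpa using hf
  rw [mulVec_eq _ _ _ _ _ _ _ hab, mulVec_eq _ _ _ _ _ _ _ hab]
  exact Lf_congr _ _ _ _ _ (hX a (by simp)) (hX b (by simp))

section sq
variable (G : PinnedGraph V) (σ : ({i // i ∈ G.inner} × Fin 2) ≃ {e // e ∈ G.edges})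

noncomputable def Sq (p : Cfg V) : Matrix ({i // i ∈ G.inner} × Fin 2) ({i // i ∈ G.inner} × Fin 2) ℝ :=
  (rMatrix 2 p G.inner G.edges).submatrix σ id

noncomputable def Wv (p : Cfg V) (e : {e // e ∈ G.edges}) : {i // i ∈ G.inner} × Fin 2 → ℝ :=
  (Sq G σ p).adjugate.mulVec (Pi.single (σ.symm e) 1)

lemma Sq_mulVec (p : Cfg V) (X) (e : {e // e ∈ G.edges}) :
    (Sq G σ p).mulVec X (σ.symm e) = (rMatrix 2 p G.inner G.edges).mulVec X e := by
  simp [Sq, mulVec, dotProduct]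

lemma R_Wv (p : Cfg V) (e : {e // e ∈ G.edges}) :
    (rMatrix 2 p G.inner G.edges).mulVec (Wv G σ p e) = Pi.single e (Sq G σ p).det := by
  ext f
  rw [← Sq_mulVec G σ, Wv, mulVec_mulVec, mul_adjugate, smul_mulVec, one_mulVec]
  by_cases h : f = e
  · subst h; simp
  · simp [Pi.single_apply, h]

lemma ker_of_det (p : Cfg V) (h : (Sq G σ p).det ≠ 0) :
    KernelTrivial (rMatrix 2 p G.inner G.edges) := by
  intro U hU
  by_contra hne
  apply h
  apply Matrix.exists_mulVec_eq_zero_iff.1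
  refine ⟨U, hne, ?_⟩
  ext i
  have := Sq_mulVec G σ p U (σ i)
  simp only [Equiv.symm_apply_apply] at this
  rw [this, hU]; rfl

lemma det_of_ker (p : Cfg V) (h : KernelTrivial (rMatrix 2 p G.inner G.edges)) :
    (Sq G σ p).det ≠ 0 := by
  intro h0
  obtain ⟨v, hv, hv0⟩ := Matrix.exists_mulVec_eq_zero_iff.2 h0
  apply hv
  apply h
  ext e
  rw [← Sq_mulVec G σ, hv0]; rfl

lemma surj_of_det (p : Cfg V) (h : (Sq G σ p).det ≠ 0) (y : {e // e ∈ G.edges} → ℝ) :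
    ∃ X, (rMatrix 2 p G.inner G.edges).mulVec X = y := by
  refine ⟨(Sq G σ p)⁻¹.mulVec (fun i => y (σ i)), ?_⟩
  ext e
  rw [← Sq_mulVec G σ, mulVec_mulVec, mul_nonsing_inv _ (isUnit_iff_ne_zero.2 h), one_mulVec]
  simp

lemma Sq_cont : Continuous (Sq G σ) := by
  apply continuous_matrix
  intro i j
  simp only [Sq, rMatrix, submatrix_apply, of_apply, id]
  split_ifs
  · fun_prop
  · fun_prop

lemma det_cont : Continuous fun p => (Sq G σ p).det := (Sq_cont G σ).matrix_det

lemma Wv_cont (e) : Continuous fun p => Wv G σ p e :=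
  (Sq_cont G σ).matrix_adjugate.matrix_mulVec continuous_const

lemma Sq_line (p q : Cfg V) (t : ℝ) : Sq G σ (p + t • (q - p)) = Sq G σ p + t • (Sq G σ q - Sq G σ p) := by
  ext i j
  simp only [Sq, rMatrix, submatrix_apply, of_apply, id, Matrix.add_apply, Matrix.smul_apply, Matrix.sub_apply]
  split_ifs
  · simp; ring
  · simp

lemma det_dense (h : ∃ p, (Sq G σ p).det ≠ 0) : Dense {p | (Sq G σ p).det ≠ 0} := by
  obtain ⟨q, hq⟩ := h
  intro p
  rw [mem_closure_iff_nhds]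
  intro W hW
  let P : Polynomial ℝ := (((Sq G σ p).map Polynomial.C) + (Polynomial.X : Polynomial ℝ) • ((Sq G σ q - Sq G σ p).map Polynomial.C)).det
  have hP : ∀ t, P.eval t = (Sq G σ (p + t • (q - p))).det := by
    intro t
    rw [Sq_line, ← Polynomial.coe_evalRingHom, RingHom.map_det]
    congr 1
    ext i j
    simp 
  have hP0 : P ≠ 0 := by
    intro h0
    have := hP 1
    rw [h0] at this
    simp at this
    exact hq this.symm
  have hc : Filter.Tendsto (fun t : ℝ => p + t • (q - p)) (nhdsWithin 0 {0}ᶜ) (nhds p) := by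
    have : Continuous (fun t : ℝ => p + t • (q - p)) := by fun_prop
    have h2 := this.tendsto 0
    simp only [zero_smul, add_zero] at h2
    exact h2.mono_left nhdsWithin_le_nhds
  have hr : ∀ᶠ t in nhdsWithin (0:ℝ) {0}ᶜ, P.eval t ≠ 0 := by
    have hfin : ({t | P.eval t = 0} \ {0} : Set ℝ).Finite := by
      apply Set.Finite.subset (P.roots.toFinset.finite_toSet)
      intro t ht
      simp [hP0]
      exact ht.1
    have : ({t | P.eval t = 0} \ {0} : Set ℝ)ᶜ ∈ nhds (0:ℝ) := hfin.isClosed.isOpen_compl.mem_nhds (by simp)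
    filter_upwards [nhdsWithin_le_nhds this, self_mem_nhdsWithin] with t ht ht0 h0
    exact ht ⟨h0, ht0⟩
  obtain ⟨t, h1, h2⟩ := ((hc.eventually hW).and hr).exists
  refine ⟨_, h1, ?_⟩
  rw [hP] at h2
  exact h2

end sq

section main
variable (G : PinnedGraph V) (σ : ({i // i ∈ G.inner} × Fin 2) ≃ {e // e ∈ G.edges})

def restr {I' J : Finset V} (h : J ⊆ I') (X : {i // i ∈ I'} × Fin 2 → ℝ) :
    {i // i ∈ J} × Fin 2 → ℝ := fun jk => X (⟨jk.1, h jk.1.2⟩, jk.2)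

lemma extz_restr {I' J : Finset V} (h : J ⊆ I') (X : {i // i ∈ I'} × Fin 2 → ℝ) (v : V)
    (hv : v ∈ J ∨ v ∉ I' ∨ extz I' X v = 0) : extz J (restr h X) v = extz I' X v := by
  by_cases hJ : v ∈ J
  · ext k; simp [extz, restr, hJ, h hJ]
  · have h0 : extz J (restr h X) v = 0 := by ext k; simp [extz, hJ]
    rw [h0]
    rcases hv with hv | hv | hv
    · exact absurd hv hJ
    · ext k; simp [extz, hv]
    · exact hv.symm

lemma count_lt (hG : IsAssur 2 G) (p : Cfg V) (hp : (Sq G σ p).det ≠ 0) (Z : Finset V)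
    (hZ : Z ⊆ G.inner) (hne : Z.Nonempty)
    (hE : G.edges.filter (fun f => ∀ v ∈ f, v ∈ Z ∪ G.pinned) ≠ G.edges) :
    (G.edges.filter (fun f => ∀ v ∈ f, v ∈ Z ∪ G.pinned)).card < 2 * Z.card := by
  set EZ := G.edges.filter (fun f => ∀ v ∈ f, v ∈ Z ∪ G.pinned) with hEZ
  have hsub : EZ ⊆ G.edges := Finset.filter_subset _ _
  have hdisj : ∀ v, v ∈ G.inner → v ∉ G.pinned := fun v hv => Finset.disjoint_left.1 G.disj hv
  have hsurj : Function.Surjective (rMatrix 2 p Z EZ).mulVecLin := by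
    intro y
    obtain ⟨X, hX⟩ := surj_of_det G σ p hp (fun f => if h : f.1 ∈ EZ then y ⟨f.1, h⟩ else 0)
    refine ⟨restr hZ X, ?_⟩
    ext ⟨f, hf⟩
    rw [Matrix.mulVecLin_apply, mulVec_congr p Z G.inner EZ G.edges (restr hZ X) X f hf (hsub hf)
      (G.loopless f (hsub hf)), hX]
    · simp [hf]
    · intro v hv
      apply extz_restr
      have := (Finset.mem_filter.1 hf).2 v hv
      rcases Finset.mem_union.1 this with h | h
      · exact Or.inl h
      · exact Or.inr (Or.inl fun h' => hdisj v h' h)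
  have hle := LinearMap.finrank_le_finrank_of_surjective hsurj
  have hle' : EZ.card ≤ 2 * Z.card := by simpa [mul_comm] using hle
  refine lt_of_le_of_ne hle' fun heq => ?_
  refine hG.2 Z G.pinned EZ ⟨hZ, subset_rfl, hsub, fun f hf v hv => (Finset.mem_filter.1 hf).2 v hv, ?_⟩
    hne hE ⟨p, heq, ?_⟩
  · intro f hf
    obtain ⟨v, hv, hvi⟩ := G.edge_inner f (hsub hf)
    refine ⟨v, hv, ?_⟩
    rcases Finset.mem_union.1 ((Finset.mem_filter.1 hf).2 v hv) with h | h
    · exact h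
    · exact absurd h (hdisj v hvi)
  · have hinj := (LinearMap.injective_iff_surjective_of_finrank_eq_finrank
      (f := (rMatrix 2 p Z EZ).mulVecLin) (by simp [heq, mul_comm])).2 hsurj
    intro U hU
    apply hinj
    simpa using hU

/-- Perturbed configuration. -/
noncomputable def pert (p : Cfg V) (Y : V → Fin 2 → ℝ) (t : ℝ) : Cfg V :=
  fun v => p v + t • !₂[- Y v 1, Y v 0]

lemma pert_cross (p : Cfg V) (Y : V → Fin 2 → ℝ) (t : ℝ) (a b : V) :
    (p a 0 - p b 0) * (pert p Y t a 1 - pert p Y t b 1) -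
    (p a 1 - p b 1) * (pert p Y t a 0 - pert p Y t b 0) = t * Lf p Y a b := by
  simp [pert, Lf]; ring

lemma pert_cont (p : Cfg V) (Y : V → Fin 2 → ℝ) : Continuous (pert p Y) := by
  unfold pert; fun_prop

lemma pert_zero (p : Cfg V) (Y : V → Fin 2 → ℝ) : pert p Y 0 = p := by
  ext v; simp [pert]

lemma transfer (p q : Cfg V) (Y : V → Fin 2 → ℝ) (a b : V)
    (hc : (p a 0 - p b 0) * (q a 1 - q b 1) - (p a 1 - p b 1) * (q a 0 - q b 0) = 0)
    (hne : ∃ Y', Lf q Y' a b ≠ 0) (h : Lf q Y a b = 0) : Lf p Y a b = 0 := by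
  obtain ⟨Y', hY'⟩ := hne
  unfold Lf at *
  by_cases h0 : q a 0 - q b 0 = 0
  · have h1 : q a 1 - q b 1 ≠ 0 := by
      intro h1; apply hY'; rw [h0, h1]; ring
    refine (mul_eq_zero.1 (?_ : (q a 1 - q b 1) * _ = 0)).resolve_left h1
    linear_combination (p a 1 - p b 1) * h + (Y a 0 - Y b 0) * hc
  · refine (mul_eq_zero.1 (?_ : (q a 0 - q b 0) * _ = 0)).resolve_left h0
    linear_combination (p a 0 - p b 0) * h - (Y a 1 - Y b 1) * hc

lemma both (p q : Cfg V) (Y : V → Fin 2 → ℝ) (a b : V)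
    (hc : (p a 0 - p b 0) * (q a 1 - q b 1) - (p a 1 - p b 1) * (q a 0 - q b 0) ≠ 0)
    (h : Lf q Y a b = 0) (h' : Lf p Y a b = 0) : Y a = Y b := by
  unfold Lf at *
  ext k
  rw [← sub_eq_zero]
  fin_cases k
  · refine (mul_eq_zero.1 (?_ : _ * (Y a 0 - Y b 0) = 0)).resolve_left hc
    linear_combination (q a 1 - q b 1) * h' - (p a 1 - p b 1) * h
  · refine (mul_eq_zero.1 (?_ : _ * (Y a 1 - Y b 1) = 0)).resolve_left hc
    linear_combination (p a 0 - p b 0) * h - (q a 0 - q b 0) * h'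

lemma exists_good (hG : IsAssur 2 G) (hdet : ∃ p, (Sq G σ p).det ≠ 0) (e : {e // e ∈ G.edges})
    (W : Set (Cfg V)) (hW : IsOpen W) (hWn : W.Nonempty) :
    ∃ p ∈ W, (Sq G σ p).det ≠ 0 ∧ ∀ j, (fun k => Wv G σ p e (j,k)) ≠ 0 := by
  let A : Set (Cfg V) := W ∩ {p | (Sq G σ p).det ≠ 0}
  have hA : IsOpen A := hW.inter ((det_cont G σ).isOpen_preimage _ isOpen_compl_singleton)
  have hAn : A.Nonempty := (det_dense G σ hdet).inter_open_nonempty W hW hWn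
  let Nz : Cfg V → Finset V := fun p => G.inner.filter (fun v => extz G.inner (Wv G σ p e) v ≠ 0)
  obtain ⟨N, hN⟩ := (Set.toFinite (Nz '' A)).exists_maximal (hAn.image Nz)
  obtain ⟨p, hpA, hpN⟩ := hN.prop
  refine ⟨p, hpA.1, hpA.2, ?_⟩
  have hp : (Sq G σ p).det ≠ 0 := hpA.2
  -- constancy near p
  have hnear : ∀ᶠ q in nhds p, q ∈ A ∧ Nz q = N := by
    have h1 : ∀ᶠ q in nhds p, q ∈ A := hA.mem_nhds hpA
    have h2 : ∀ᶠ q in nhds p, N ⊆ Nz q := by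
      have : ∀ᶠ q in nhds p, ∀ v ∈ N, extz G.inner (Wv G σ q e) v ≠ 0 := by
        rw [Filter.eventually_all_finset]
        intro v hv
        rw [← hpN] at hv
        have hc : Continuous fun q => extz G.inner (Wv G σ q e) v := by
          refine continuous_pi fun k => ?_
          unfold extz
          split_ifs
          · exact (continuous_apply _).comp (Wv_cont G σ e)
          · exact continuous_const
        exact hc.continuousAt.eventually_ne (Finset.mem_filter.1 hv).2
      filter_upwards [this] with q hq v hv
      have hvN := hv
      rw [← hpN] at hvN
      exact Finset.mem_filter.2 ⟨(Finset.mem_filter.1 hvN).1, hq v hv⟩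
    filter_upwards [h1, h2] with q hq1 hq2
    exact ⟨hq1, (hN.eq_of_le ⟨q, hq1, rfl⟩ hq2).symm⟩
  have hNI : N ⊆ G.inner := by rw [← hpN]; exact Finset.filter_subset _ _
  set Z := G.inner \ N with hZdef
  have hZI : Z ⊆ G.inner := Finset.sdiff_subset
  have hzero : ∀ q, Nz q = N → ∀ v, v ∉ N → extz G.inner (Wv G σ q e) v = 0 := by
    intro q hq v hv
    by_cases hvi : v ∈ G.inner
    · by_contra h
      exact hv (hq ▸ Finset.mem_filter.2 ⟨hvi, h⟩)
    · ext k; simp [extz, hvi]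
  have hnz : ∀ q, Nz q = N → ∀ v, v ∈ N → extz G.inner (Wv G σ q e) v ≠ 0 := by
    intro q hq v hv
    rw [← hq] at hv
    exact (Finset.mem_filter.1 hv).2
  suffices hZe : Z = ∅ by
    intro j hj
    have : j.1 ∈ N := by
      by_contra h
      have : j.1 ∈ Z := Finset.mem_sdiff.2 ⟨j.2, h⟩
      rw [hZe] at this
      simp at this
    apply hnz p hpN j.1 this
    ext k
    simpa [extz] using congrFun hj k
  by_contra hZne
  have hZn : Z.Nonempty := Finset.nonempty_iff_ne_empty.2 hZne
  have hdisj : ∀ v, v ∈ G.inner → v ∉ G.pinned := fun v hv => Finset.disjoint_left.1 G.disj hv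
  have hcov : ∀ v, v ∈ Z ∪ G.pinned ↔ v ∉ N := by
    intro v
    have := Finset.mem_univ v
    rw [← G.cover, Finset.mem_union] at this
    have h1 := hdisj v
    have h2 := @hNI v
    simp only [hZdef, Finset.mem_union, Finset.mem_sdiff]
    tauto
  set EZ := G.edges.filter (fun f => ∀ v ∈ f, v ∈ Z ∪ G.pinned) with hEZ
  have hsub : EZ ⊆ G.edges := Finset.filter_subset _ _
  -- row values of W at q
  have hval : ∀ q (f : {f // f ∈ G.edges}), f ≠ e →
      (rMatrix 2 q G.inner G.edges).mulVec (Wv G σ q e) f = 0 := by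
    intro q f hf
    rw [R_Wv]; simp [hf]
  have hvale : (rMatrix 2 p G.inner G.edges).mulVec (Wv G σ p e) e ≠ 0 := by
    rw [R_Wv]; simpa using hp
  have heZ : e.1 ∉ EZ := by
    intro he
    apply hvale
    rw [mulVec_congr p G.inner G.inner G.edges G.edges (Wv G σ p e) 0 e.1 e.2 e.2 (G.loopless _ e.2)]
    · simp
    · intro v hv
      rw [hzero p hpN v ((hcov v).1 ((Finset.mem_filter.1 he).2 v hv))]
      ext k; simp [extz]
  have hEne : EZ ≠ G.edges := fun h => heZ (by rw [h]; exact e.2)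
  have hcount := count_lt G σ hG p hp Z hZI hZn hEne
  set F := (G.edges \ EZ).erase e.1 with hF
  have hFE : F ⊆ G.edges := (Finset.erase_subset _ _).trans Finset.sdiff_subset
  have hFcard : 2 * N.card ≤ F.card := by
    have h1 : F.card = (G.edges \ EZ).card - 1 :=
      Finset.card_erase_of_mem (Finset.mem_sdiff.2 ⟨e.2, heZ⟩)
    have h2 := Finset.card_sdiff_add_card_eq_card hsub
    have h3 := Finset.card_sdiff_add_card_eq_card hNI
    have h4 : 2 * G.inner.card = G.edges.card := by
      have := Fintype.card_congr σ
      simp at this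
      omega
    change (G.edges.filter (fun f => ∀ v ∈ f, v ∈ Z ∪ G.pinned)).card < 2 * Z.card at hcount
    rw [← hEZ] at hcount
    rw [← hZdef] at h3
    omega
  -- not surjective
  have hFN : ∀ q (X : {i // i ∈ G.inner} × Fin 2 → ℝ), (∀ v, v ∉ N → extz G.inner X v = 0) →
      ∀ f (hf : f ∈ F), (rMatrix 2 q N F).mulVec (restr hNI X) ⟨f, hf⟩ =
        (rMatrix 2 q G.inner G.edges).mulVec X ⟨f, hFE hf⟩ := by
    intro q X hX f hf
    apply mulVec_congr
    · exact G.loopless f (hFE hf)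
    · intro v hv
      apply extz_restr
      by_cases h : v ∈ N
      · exact Or.inl h
      · exact Or.inr (Or.inr (hX v h))
  have hFe : ∀ f (hf : f ∈ F), (⟨f, hFE hf⟩ : {f // f ∈ G.edges}) ≠ e := by
    intro f hf h
    exact (Finset.mem_erase.1 hf).1 (congrArg Subtype.val h)
  let T := (rMatrix 2 p N F).mulVecLin
  have hTker : T (restr hNI (Wv G σ p e)) = 0 := by
    ext ⟨f, hf⟩
    change (rMatrix 2 p N F).mulVec _ _ = 0
    rw [hFN p _ (hzero p hpN) f hf, hval p _ (hFe f hf)]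
  have hTne : restr hNI (Wv G σ p e) ≠ 0 := by
    intro h
    apply hvale
    have : Wv G σ p e = 0 := by
      ext ⟨⟨j, hj⟩, k⟩
      have h1 : extz G.inner (Wv G σ p e) j = 0 := by
        by_cases hjN : j ∈ N
        · rw [← extz_restr hNI _ j (Or.inl hjN), h]
          ext k; simp [extz]
        · exact hzero p hpN j hjN
      simpa [extz, hj] using congrFun h1 k
    rw [this]; simp
  have hrange : LinearMap.range T < ⊤ := by
    rw [lt_top_iff_ne_top]
    intro htop
    have hsurj := LinearMap.range_eq_top.1 htop
    have hle := LinearMap.finrank_le_finrank_of_surjective hsurj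
    have heq : Module.finrank ℝ ({i // i ∈ N} × Fin 2 → ℝ) = Module.finrank ℝ ({f // f ∈ F} → ℝ) := by
      simp at hle ⊢
      omega
    have hinj := (LinearMap.injective_iff_surjective_of_finrank_eq_finrank heq).2 hsurj
    exact hTne (hinj (by rw [hTker, map_zero]))
  obtain ⟨φ, hφ, hφT⟩ := Submodule.exists_le_ker_of_lt_top _ hrange
  have hφsum : ∀ y, φ y = ∑ f, y f * φ (Pi.single f 1) := by
    intro y
    conv_lhs => rw [pi_eq_sum_univ' y]
    rw [map_sum]
    refine Finset.sum_congr rfl fun f _ => ?_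
    rw [map_smul, smul_eq_mul]
  let rows : ({i // i ∈ G.inner} × Fin 2 → ℝ) → {f // f ∈ F} → ℝ := fun X f =>
    (rMatrix 2 p G.inner G.edges).mulVec X ⟨f.1, hFE f.2⟩
  have hrows : ∀ X : {i // i ∈ G.inner} × Fin 2 → ℝ, (∀ v, v ∉ N → extz G.inner X v = 0) →
      φ (rows X) = 0 := by
    intro X hX
    have : rows X = T (restr hNI X) := by
      ext ⟨f, hf⟩
      exact (hFN p X hX f hf).symm
    rw [this]
    exact hφT ⟨_, rfl⟩
  obtain ⟨X, hX⟩ : ∃ X, φ (rows X) ≠ 0 := by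
    by_contra hcon
    push Not at hcon
    apply hφ
    ext y
    obtain ⟨X, hX⟩ := surj_of_det G σ p hp
      (fun f => if h : f.1 ∈ F then (Pi.single y 1 : {f // f ∈ F} → ℝ) ⟨f.1, h⟩ else 0)
    have h1 : rows X = Pi.single y 1 := by
      ext f
      simp [rows, hX]
    have := hcon X
    rw [h1] at this
    simpa using this
  let XN : {i // i ∈ G.inner} × Fin 2 → ℝ := fun jk => if jk.1.1 ∈ N then X jk else 0
  let XZ : {i // i ∈ G.inner} × Fin 2 → ℝ := fun jk => if jk.1.1 ∈ N then 0 else X jk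
  have hsplit : rows X = rows XN + rows XZ := by
    have : X = XN + XZ := by
      ext jk; by_cases h : jk.1.1 ∈ N <;> simp [XN, XZ, h]
    ext f
    simp only [rows, Pi.add_apply]
    conv_lhs => rw [this]
    rw [mulVec_add]; rfl
  have hXN : φ (rows XN) = 0 := by
    apply hrows
    intro v hv
    ext k; simp [extz, XN, hv]
  rw [hsplit, map_add, hXN, zero_add, hφsum] at hX
  obtain ⟨⟨f, hf⟩, -, hfne⟩ := Finset.exists_ne_zero_of_sum_ne_zero hX
  have hω := right_ne_zero_of_mul hfne
  have hXZf := left_ne_zero_of_mul hfne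
  let f' : {f // f ∈ G.edges} := ⟨f, hFE hf⟩
  -- endpoints
  have hj : ∃ j ∈ f, j ∉ N := by
    by_contra hcon
    push Not at hcon
    apply hXZf
    change (rMatrix 2 p G.inner G.edges).mulVec XZ _ = 0
    rw [mulVec_congr p G.inner G.inner G.edges G.edges XZ 0 f (hFE hf) (hFE hf) (G.loopless _ (hFE hf))]
    · simp
    · intro v hv
      ext k; simp [extz, XZ, hcon v hv]
  have hu : ∃ u ∈ f, u ∈ N := by
    by_contra hcon
    push Not at hcon
    have := (Finset.mem_sdiff.1 (Finset.mem_erase.1 hf).2).2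
    exact this (Finset.mem_filter.2 ⟨hFE hf, fun v hv => (hcov v).2 (hcon v hv)⟩)
  let Y := extz G.inner (Wv G σ p f')
  have hpert : ∀ᶠ t in nhds (0:ℝ), pert p Y t ∈ A ∧ Nz (pert p Y t) = N := by
    have := (pert_cont p Y).tendsto 0
    rw [pert_zero] at this
    exact this.eventually hnear
  have hpert' : ∀ᶠ t in nhdsWithin (0:ℝ) {0}ᶜ, (pert p Y t ∈ A ∧ Nz (pert p Y t) = N) ∧ t ≠ 0 :=
    (hpert.filter_mono nhdsWithin_le_nhds).and self_mem_nhdsWithin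
  obtain ⟨t, ⟨hqA, hqN⟩, ht⟩ := hpert'.exists
  set q := pert p Y t with hq
  set U := Wv G σ q e with hU
  have hUother : ∀ g : {f // f ∈ G.edges}, g ≠ e → g ≠ f' →
      (rMatrix 2 p G.inner G.edges).mulVec U g = 0 := by
    rintro ⟨g, hg⟩ hge hgf
    have h1 := hval q ⟨g, hg⟩ hge
    have h2 : (rMatrix 2 p G.inner G.edges).mulVec (Wv G σ p f') ⟨g, hg⟩ = 0 := by
      rw [R_Wv]; simp [hgf]
    obtain ⟨X', hX'⟩ := surj_of_det G σ q hqA.2 (fun _ => 1)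
    have h3 := congrFun hX' ⟨g, hg⟩
    have hnd := G.loopless g hg
    clear hge hgf
    induction g with | _ a b
    have hab : a ≠ b := by simpa using hnd
    rw [mulVec_eq _ _ _ _ _ _ _ hab] at h1 h2 h3 ⊢
    refine transfer p q _ a b ?_ ⟨_, by rw [h3]; exact one_ne_zero⟩ h1
    rw [hq, pert_cross, h2, mul_zero]
  have hUf : (rMatrix 2 p G.inner G.edges).mulVec U f' = 0 := by
    have h0 := hrows U (hzero q hqN)
    rw [hφsum, Finset.sum_eq_single ⟨f, hf⟩] at h0
    · exact (mul_eq_zero.1 h0).resolve_right hω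
    · rintro ⟨g, hg⟩ - hgf
      have : rows U ⟨g, hg⟩ = 0 := by
        apply hUother _ (hFe g hg)
        intro h
        apply hgf
        simpa [f'] using h
      rw [this, zero_mul]
    · simp
  have hUq : (rMatrix 2 q G.inner G.edges).mulVec U f' = 0 := hval q f' (hFe f hf)
  have hVf : (rMatrix 2 p G.inner G.edges).mulVec (Wv G σ p f') f' ≠ 0 := by
    rw [R_Wv]; simpa using hp
  have hconst : ∀ a b, a ∈ f → b ∈ f → extz G.inner U a = extz G.inner U b := by
    have hnd := G.loopless f (hFE hf)
    clear_value q U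
    obtain ⟨a, b, rfl⟩ : ∃ a b, f = s(a, b) := by
      induction f with | _ a b
      exact ⟨a, b, rfl⟩
    have hab : a ≠ b := by simpa using hnd
    have hmain : extz G.inner U a = extz G.inner U b := by
      rw [mulVec_eq _ _ _ _ _ _ _ hab] at hUf hUq hVf
      refine both p q _ a b ?_ hUq hUf
      rw [hq, pert_cross]
      exact mul_ne_zero ht hVf
    intro x y hx hy
    rcases Sym2.mem_iff.1 hx with rfl | rfl <;> rcases Sym2.mem_iff.1 hy with rfl | rfl <;>
      simp [hmain]
  obtain ⟨j, hjf, hjN⟩ := hj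
  obtain ⟨u, huf, huN⟩ := hu
  apply hnz q hqN u huN
  rw [← hU, hconst u j huf hjf]
  exact hzero q hqN j hjN

end main

lemma erase_iff (G : PinnedGraph V) (p : Cfg V) (e : Sym2 V) (he : e ∈ G.edges)
    (X : {i // i ∈ G.inner} × Fin 2 → ℝ) :
    (rMatrix 2 p G.inner (G.edges.erase e)).mulVec X = 0 ↔
      ∀ f : {f // f ∈ G.edges}, f ≠ ⟨e, he⟩ → (rMatrix 2 p G.inner G.edges).mulVec X f = 0 := by
  constructor
  · rintro h ⟨f, hf⟩ hne
    have hf' : f ∈ G.edges.erase e := Finset.mem_erase.2 ⟨fun h => hne (Subtype.ext h), hf⟩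
    exact congrFun h ⟨f, hf'⟩
  · intro h
    ext ⟨f, hf⟩
    exact h ⟨f, (Finset.mem_erase.1 hf).2⟩ fun h => (Finset.mem_erase.1 hf).1 (congrArg Subtype.val h)

lemma kernel_erase (G : PinnedGraph V) (σ : ({i // i ∈ G.inner} × Fin 2) ≃ {e // e ∈ G.edges})
    (p : Cfg V) (hp : (Sq G σ p).det ≠ 0) (e : Sym2 V) (he : e ∈ G.edges) :
    LinearMap.ker (rMatrix 2 p G.inner (G.edges.erase e)).mulVecLin =
      Submodule.span ℝ {Wv G σ p ⟨e, he⟩} := by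
  ext X
  rw [LinearMap.mem_ker, Matrix.mulVecLin_apply, erase_iff G p e he, Submodule.mem_span_singleton]
  constructor
  · intro h
    refine ⟨(rMatrix 2 p G.inner G.edges).mulVec X ⟨e, he⟩ / (Sq G σ p).det, ?_⟩
    rw [← sub_eq_zero]
    apply ker_of_det G σ p hp
    ext f
    rw [mulVec_sub, mulVec_smul, R_Wv]
    by_cases hf : f = ⟨e, he⟩
    · subst hf
      simp [hp]
    · simp [hf, h f hf]
  · rintro ⟨c, rfl⟩ f hf
    rw [mulVec_smul, R_Wv]
    simp [hf]

lemma Wv_ne (G : PinnedGraph V) (σ : ({i // i ∈ G.inner} × Fin 2) ≃ {e // e ∈ G.edges})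
    (p : Cfg V) (hp : (Sq G σ p).det ≠ 0) (e) : Wv G σ p e ≠ 0 := by
  intro h
  have := congrFun (R_Wv G σ p e) e
  rw [h] at this
  simp at this
  exact hp this.symm

lemma exists_set (G : PinnedGraph V) (hG : IsAssur 2 G) :
    ∃ (σ : ({i // i ∈ G.inner} × Fin 2) ≃ {e // e ∈ G.edges}) (S : Set (Cfg V)),
      IsOpen S ∧ Dense S ∧ ∀ p ∈ S, (Sq G σ p).det ≠ 0 ∧
        ∀ e j, (fun k => Wv G σ p e (j,k)) ≠ 0 := by
  obtain ⟨⟨p₀, hcard, hp₀⟩, -⟩ := id hG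
  have hc : Fintype.card ({i // i ∈ G.inner} × Fin 2) = Fintype.card {e // e ∈ G.edges} := by
    simp [hcard, mul_comm]
  let σ := Fintype.equivOfCardEq hc
  have hdet : ∃ p, (Sq G σ p).det ≠ 0 := ⟨p₀, det_of_ker G σ p₀ hp₀⟩
  have hDo : IsOpen {p | (Sq G σ p).det ≠ 0} :=
    (det_cont G σ).isOpen_preimage _ isOpen_compl_singleton
  let Se : {e // e ∈ G.edges} → Set (Cfg V) := fun e => {p | ∀ j, (fun k => Wv G σ p e (j,k)) ≠ 0}
  have hSo : ∀ e, IsOpen (Se e) := by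
    intro e
    have : Se e = ⋂ j, {p | (fun k => Wv G σ p e (j,k)) ≠ 0} := by
      ext p; simp [Se]
    rw [this]
    refine isOpen_iInter_of_finite fun j => ?_
    have hc : Continuous fun p => (fun k => Wv G σ p e (j,k)) :=
      continuous_pi fun k => (continuous_apply _).comp (Wv_cont G σ e)
    exact hc.isOpen_preimage _ isOpen_compl_singleton
  have hSd : ∀ e, Dense (Se e) := by
    intro e
    rw [dense_iff_inter_open]
    intro W hW hWn
    obtain ⟨p, hpW, -, hp⟩ := exists_good G σ hG hdet e W hW hWn
    exact ⟨p, hpW, hp⟩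
  refine ⟨σ, {p | (Sq G σ p).det ≠ 0} ∩ ⋂ e, Se e, hDo.inter (isOpen_iInter_of_finite hSo),
    (det_dense G σ hdet).inter_of_isOpen_left (dense_iInter_of_isOpen hSo hSd) hDo, ?_⟩
  rintro p ⟨h1, h2⟩
  exact ⟨h1, fun e => Set.mem_iInter.1 h2 e⟩

/-- For every `2`-Assur graph there is a dense open set of configurations
at which the pinned rigidity matrix is invertible and, for every edge, deleting its row
leaves a matrix with a one-dimensional kernel all of whose nonzero vectors are nonzero
at every inner vertex.  In particular every `2`-Assur graph is strongly `2`-Assur. -/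
theorem stmt13 {V : Type} [Fintype V] [DecidableEq V]
    (G : PinnedGraph V) (hG : IsAssur 2 G) :
    (∃ S : Set (V → EuclideanSpace ℝ (Fin 2)), IsOpen S ∧ Dense S ∧
      ∀ p ∈ S, KernelTrivial (rMatrix 2 p G.inner G.edges) ∧
        ∀ e ∈ G.edges,
          Module.finrank ℝ
            (LinearMap.ker (rMatrix 2 p G.inner (G.edges.erase e)).mulVecLin) = 1 ∧
          ∀ U : {i // i ∈ G.inner} × Fin 2 → ℝ,
            (rMatrix 2 p G.inner (G.edges.erase e)).mulVec U = 0 → U ≠ 0 →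
            ∀ i : {i // i ∈ G.inner}, (fun k => U (i, k)) ≠ 0) ∧
    IsStronglyAssur 2 G := by
  obtain ⟨σ, S, hSo, hSd, hS⟩ := exists_set G hG
  refine ⟨⟨S, hSo, hSd, fun p hp => ?_⟩, hG, S, hSo, hSd, fun p hp e he => ?_⟩
  · obtain ⟨hdet, hW⟩ := hS p hp
    refine ⟨ker_of_det G σ p hdet, fun e he => ?_⟩
    have hk := kernel_erase G σ p hdet e he
    refine ⟨?_, fun U hU hne i hi => ?_⟩
    · rw [hk]
      exact finrank_span_singleton (Wv_ne G σ p hdet _)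
    · have hm : U ∈ LinearMap.ker (rMatrix 2 p G.inner (G.edges.erase e)).mulVecLin := by
        simpa using hU
      rw [hk, Submodule.mem_span_singleton] at hm
      obtain ⟨c, rfl⟩ := hm
      have hc : c ≠ 0 := by
        rintro rfl
        simp at hne
      apply hW ⟨e, he⟩ i
      ext k
      have := congrFun hi k
      simpa [hc] using this
  · obtain ⟨hdet, hW⟩ := hS p hp
    refine ⟨fun i => WithLp.toLp 2 (fun k => Wv G σ p ⟨e, he⟩ (i, k)), fun i hi => ?_, ?_⟩
    · apply hW ⟨e, he⟩ i
      ext k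
      exact congrArg (fun x : EuclideanSpace ℝ (Fin 2) => x k) hi
    · rw [erase_iff G p e he]
      intro f hf
      change (rMatrix 2 p G.inner G.edges).mulVec (Wv G σ p ⟨e, he⟩) f = 0
      rw [R_Wv]
      simp [hf]
end

section
/- Let d ≥ 1 and let G̃ = (I,P;E) be a strongly d-Assur graph. Then there is a dense open set of configurations p : I ∪ P → ℝ^d such that for every inner vertex v ∈ I with I ∖ {v} nonempty, there exists a vector U ∈ (ℝ^d)^{I∖{v}} with R(G̃ − v, p)·U = 0 and U(i) ≠ 0 for every i ∈ I ∖ {v}; that is, at a generic configuration, removal of any inner vertex yields an infinitesimal motion that is nonzero at all remaining inner vertices. Here G̃ − v denotes the pinned graph (I ∖ {v}, P; E_v), where E_v is the set of edges of E not incident to v. -/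
open Matrix

variable {V : Type} [Fintype V] [DecidableEq V]

/-- For a strongly `d`-Assur graph there is a dense open set of
configurations at which, for every inner vertex `v` (leaving some inner vertex), the
pinned rigidity matrix of `G - v` has a kernel vector that is nonzero at every
remaining inner vertex: removal of any inner vertex yields an infinitesimal motion
nonzero at all remaining inner vertices. -/
theorem stmt16 {V : Type} [Fintype V] [DecidableEq V] (d : ℕ) (hd : 1 ≤ d)
    (G : PinnedGraph V) (hG : IsStronglyAssur d G) :
    ∃ S : Set (V → EuclideanSpace ℝ (Fin d)), IsOpen S ∧ Dense S ∧
      ∀ p ∈ S, ∀ v ∈ G.inner, (G.inner.erase v).Nonempty →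
        ∃ U : {i // i ∈ G.inner.erase v} → EuclideanSpace ℝ (Fin d),
          (rMatrix d p (G.inner.erase v) (G.edges.filter fun e => ¬ v ∈ e)).mulVec
            (fun ik => U ik.1 ik.2) = 0 ∧
          ∀ i, U i ≠ 0 := by
  classical
  obtain ⟨⟨⟨p0, -, hk⟩, -⟩, S, hSo, hSd, hS⟩ := hG
  refine ⟨S, hSo, hSd, ?_⟩
  intro p hp v hv _
  have hex : ∃ e ∈ G.edges, v ∈ e := by
    by_contra hcon
    push Not at hcon
    have h0 := hk (fun ik => if (ik.1 : V) = v then 1 else 0) (by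
      funext e
      simp only [Matrix.mulVec, dotProduct, Pi.zero_apply]
      apply Finset.sum_eq_zero
      intro ik _
      by_cases h : (ik.1 : V) = v
      · have hn : ¬ (ik.1 : V) ∈ (e : Sym2 V) := by
          rw [h]; exact hcon e.1 e.2
        simp [rMatrix, hn]
      · simp [h])
    have h1 := congrFun h0 (⟨v, hv⟩, ⟨0, hd⟩)
    simp at h1
  obtain ⟨e, he, hve⟩ := hex
  obtain ⟨U, hU, hM⟩ := hS p hp e he
  refine ⟨fun i => U ⟨i.1, Finset.mem_of_mem_erase i.2⟩, ?_, fun i => hU _⟩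
  funext f
  have hf := Finset.mem_filter.1 f.2
  have hfe : f.1 ∈ G.edges.erase e :=
    Finset.mem_erase.2 ⟨fun h => hf.2 (h ▸ hve), hf.1⟩
  have hrow := congrFun hM ⟨f.1, hfe⟩
  simp only [Matrix.mulVec, dotProduct, Pi.zero_apply] at hrow ⊢
  rw [← hrow]
  let φ : {i // i ∈ G.inner.erase v} × Fin d → {i // i ∈ G.inner} × Fin d :=
    fun ik => (⟨ik.1.1, Finset.mem_of_mem_erase ik.1.2⟩, ik.2)
  refine Finset.sum_of_injOn φ ?_ ?_ ?_ ?_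
  · rintro ⟨⟨a, ha⟩, k⟩ _ ⟨⟨b, hb⟩, l⟩ _ h
    simpa [φ] using h
  · intro _ _; simp
  · rintro ⟨⟨a, ha⟩, k⟩ _ h
    have hav : a = v := by
      by_contra hne
      exact h ⟨(⟨a, Finset.mem_erase.2 ⟨hne, ha⟩⟩, k), by simp, rfl⟩
    subst hav
    simp [rMatrix, hf.2]
  · intro ik _
    rfl
end
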